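/- arXiv:1312.5191 — 4 statements merged into one kernel-verified Lean document; each statement's English description precedes it below -/
import Mathlib

section
/- Let d ≥ 1 be an integer, p > d a real exponent, and v > 0. Then E(v) = -((p-d)/p) · (d/p)^{d/(p-d)} · (S_{d,p} v)^{p/(p-d)}. -/
open MeasureTheory Filter Metric

noncomputable section

/-- Euclidean space ℝ^d. -/
abbrev Rd (d : ℕ) := EuclideanSpace ℝ (Fin d)

/-- `u` is smooth and compactly supported. -/
def SmoothCS (d : ℕ) (u : Rd d → ℝ) : Prop :=
  ContDiff ℝ (⊤ : ℕ∞) u ∧ HasCompactSupport u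

/-- The functional Q_V[u] = ∫ (|∇u|^p − V |u|^p). -/
def Qf (d : ℕ) (p : ℝ) (V u : Rd d → ℝ) : ℝ :=
  ∫ x, (‖fderiv ℝ u x‖ ^ p - V x * |u x| ^ p)

/-- λ_p(V): the infimum of the Rayleigh quotients Q_V[u] / ‖u‖_p^p over nonzero
smooth compactly supported u. -/
def lam (d : ℕ) (p : ℝ) (V : Rd d → ℝ) : ℝ :=
  sInf {r : ℝ | ∃ u : Rd d → ℝ, SmoothCS d u ∧ u ≠ 0 ∧
    r = Qf d p V u / ∫ x, |u x| ^ p}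

/-- The sharp constant S_{d,p} in ‖u‖_∞^p ≤ S ‖∇u‖_p^d ‖u‖_p^{p-d}. -/
def SobolevSharp (d : ℕ) (p : ℝ) : ℝ :=
  sInf {S : ℝ | ∀ u : Rd d → ℝ, SmoothCS d u →
    (⨆ x, |u x|) ^ p ≤ S * (∫ x, ‖fderiv ℝ u x‖ ^ p) ^ ((d : ℝ) / p) *
      (∫ x, |u x| ^ p) ^ ((p - d) / p)}

/-- E(v) = inf { ‖∇u‖_p^p − v |u(0)|^p : ‖u‖_p = 1 }. -/
def Efun (d : ℕ) (p v : ℝ) : ℝ :=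
  sInf {r : ℝ | ∃ u : Rd d → ℝ, SmoothCS d u ∧ (∫ x, |u x| ^ p) = 1 ∧
    r = (∫ x, ‖fderiv ℝ u x‖ ^ p) - v * |u (0 : Rd d)| ^ p}

/-- ω_d, the surface area of the unit sphere in ℝ^d. -/
def omegaD (d : ℕ) : ℝ := d * (volume (ball (0 : Rd d) 1)).toReal

/-- The `p`-energy of the rescaled and translated function `y ↦ c * u (x + l • y)`. -/
theorem integral_norm_fderiv_rescale {d : ℕ} {p : ℝ} (u : Rd d → ℝ) (x : Rd d) {c l : ℝ}
    (hc : 0 < c) (hl : 0 < l) :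
    (∫ y, ‖fderiv ℝ (fun y => c * u (x + l • y)) y‖ ^ p) =
      c ^ p * l ^ p * (l ^ (d : ℝ))⁻¹ * ∫ y, ‖fderiv ℝ u y‖ ^ p := by
  have hderiv : ∀ y, ‖fderiv ℝ (fun y => c * u (x + l • y)) y‖ ^ p =
      (c ^ p * l ^ p) * ‖fderiv ℝ u (x + l • y)‖ ^ p := by
    intro y
    have h : fderiv ℝ (fun y => c * u (x + l • y)) y = (c * l) • fderiv ℝ u (x + l • y) := by
      have h1 : fderiv ℝ (fun y => c • u (x + l • y)) y
          = c • fderiv ℝ (fun y => u (x + l • y)) y :=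
        congrFun (fderiv_const_smul_field (f := fun y => u (x + l • y)) c) y
      have h2 : fderiv ℝ (fun y => u (x + l • y)) y
          = l • fderiv ℝ (fun z => u (x + z)) (l • y) :=
        fderiv_comp_smul (f := fun z => u (x + z)) l
      rw [fderiv_comp_add_left] at h2
      simp only [smul_eq_mul] at h1
      rw [h1, h2, smul_smul]
    rw [h, norm_smul, Real.norm_of_nonneg (by positivity),
      Real.mul_rpow (by positivity) (norm_nonneg _), Real.mul_rpow hc.le hl.le]
  simp_rw [hderiv]
  rw [integral_const_mul, Measure.integral_comp_smul volume
    (fun z => ‖fderiv ℝ u (x + z)‖ ^ p) l,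
    integral_add_left_eq_self (fun z => ‖fderiv ℝ u z‖ ^ p) x]
  simp only [finrank_euclideanSpace, Fintype.card_fin, smul_eq_mul, Real.rpow_natCast]
  rw [abs_of_nonneg (by positivity)]
  ring

/-- The `p`-th power of the `L^p` norm of `y ↦ c * u (x + l • y)`. -/
theorem integral_abs_rescale {d : ℕ} {p : ℝ} (u : Rd d → ℝ) (x : Rd d) {c l : ℝ}
    (hc : 0 < c) (hl : 0 < l) :
    (∫ y, |c * u (x + l • y)| ^ p) = c ^ p * (l ^ (d : ℝ))⁻¹ * ∫ y, |u y| ^ p := by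
  have habs : ∀ y, |c * u (x + l • y)| ^ p = c ^ p * |u (x + l • y)| ^ p := by
    intro y
    rw [abs_mul, abs_of_pos hc, Real.mul_rpow hc.le (abs_nonneg _)]
  simp_rw [habs]
  rw [integral_const_mul, Measure.integral_comp_smul volume (fun z => |u (x + z)| ^ p) l,
    integral_add_left_eq_self (fun z => |u z| ^ p) x]
  simp only [finrank_euclideanSpace, Fintype.card_fin, smul_eq_mul, Real.rpow_natCast]
  rw [abs_of_nonneg (by positivity)]
  ring

theorem SmoothCS.rescale {d : ℕ} {u : Rd d → ℝ} (hu : SmoothCS d u) (x : Rd d) (c : ℝ) {l : ℝ}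
    (hl : 0 < l) : SmoothCS d (fun y => c * u (x + l • y)) := by
  refine ⟨contDiff_const.mul (hu.1.comp (contDiff_const.add (contDiff_const_smul l))), ?_⟩
  have h := hu.2.comp_homeomorph
    ((Homeomorph.smulOfNeZero (α := Rd d) l hl.ne').trans (Homeomorph.addLeft x))
  exact h.mul_left (f := fun _ => c)

theorem SmoothCS.integral_abs_rpow_pos {d : ℕ} {p : ℝ} (hp : 0 < p) {u : Rd d → ℝ}
    (hu : SmoothCS d u) {x : Rd d} (hx : u x ≠ 0) : 0 < ∫ y, |u y| ^ p := by
  have hcont : Continuous fun y => |u y| ^ p :=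
    hu.1.continuous.abs.rpow_const fun _ => Or.inr hp.le
  refine hcont.integral_pos_of_hasCompactSupport_nonneg_nonzero ?_
    (fun y => by positivity) (x := x) (by positivity)
  exact hu.2.comp_left (g := fun t : ℝ => |t| ^ p) (by simp [Real.zero_rpow hp.ne'])

theorem SmoothCS.bddAbove_abs {d : ℕ} {u : Rd d → ℝ} (hu : SmoothCS d u) :
    BddAbove (Set.range fun x => |u x|) :=
  hu.1.continuous.abs.bddAbove_range_of_hasCompactSupport (hu.2.comp_left (g := abs) abs_zero)

theorem exists_smoothCS_apply_zero (d : ℕ) : ∃ u : Rd d → ℝ, SmoothCS d u ∧ u 0 = 1 := by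
  let f : ContDiffBump (0 : Rd d) := ⟨1, 2, one_pos, one_lt_two⟩
  exact ⟨f, ⟨f.contDiff, f.hasCompactSupport⟩,
    f.one_of_mem_closedBall (mem_closedBall_self f.rIn_pos.le)⟩

/-- Membership of a constant in the set defining `SobolevSharp`. -/
def IsSobolevConst (d : ℕ) (p S : ℝ) : Prop :=
  ∀ u : Rd d → ℝ, SmoothCS d u →
    (⨆ x, |u x|) ^ p ≤ S * (∫ x, ‖fderiv ℝ u x‖ ^ p) ^ ((d : ℝ) / p) *
      (∫ x, |u x| ^ p) ^ ((p - d) / p)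

/-- The set of energies whose infimum is `Efun`. -/
def energySet (d : ℕ) (p v : ℝ) : Set ℝ :=
  {r : ℝ | ∃ u : Rd d → ℝ, SmoothCS d u ∧ (∫ x, |u x| ^ p) = 1 ∧
    r = (∫ x, ‖fderiv ℝ u x‖ ^ p) - v * |u (0 : Rd d)| ^ p}

theorem integral_norm_fderiv_rpow_nonneg {d : ℕ} {p : ℝ} (u : Rd d → ℝ) :
    0 ≤ ∫ x, ‖fderiv ℝ u x‖ ^ p := integral_nonneg fun _ => by positivity

theorem integral_abs_rpow_nonneg {d : ℕ} {p : ℝ} (u : Rd d → ℝ) :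
    0 ≤ ∫ x, |u x| ^ p := integral_nonneg fun _ => by positivity

theorem IsSobolevConst.pos {d : ℕ} {p S : ℝ} (hS : IsSobolevConst d p S) : 0 < S := by
  obtain ⟨u, hu, hu0⟩ := exists_smoothCS_apply_zero d
  have hsup : 0 < ⨆ x, |u x| :=
    lt_of_lt_of_le (by simp [hu0]) (le_ciSup hu.bddAbove_abs 0)
  have h := (Real.rpow_pos_of_pos hsup p).trans_le (hS u hu)
  rw [mul_assoc] at h
  exact pos_of_mul_pos_left h (mul_nonneg
    (Real.rpow_nonneg (integral_norm_fderiv_rpow_nonneg u) _)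
    (Real.rpow_nonneg (integral_abs_rpow_nonneg u) _))

/-- The rescalings of a nonzero function produce a one-parameter family of energies. -/
theorem rescaled_mem_energySet {d : ℕ} {p v : ℝ} (hp : 0 < p) {u : Rd d → ℝ}
    (hu : SmoothCS d u) {x : Rd d} (hx : u x ≠ 0) {l : ℝ} (hl : 0 < l) :
    (l ^ p * (∫ y, ‖fderiv ℝ u y‖ ^ p) - v * (l ^ (d : ℝ) * |u x| ^ p)) / (∫ y, |u y| ^ p)
      ∈ energySet d p v := by
  have hN := hu.integral_abs_rpow_pos hp hx
  set N := ∫ y, |u y| ^ p with hNdef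
  have hld : 0 < l ^ (d : ℝ) := Real.rpow_pos_of_pos hl _
  have hc : 0 < (l ^ (d : ℝ) / N) ^ p⁻¹ := by positivity
  have hcp : ((l ^ (d : ℝ) / N) ^ p⁻¹) ^ p = l ^ (d : ℝ) / N :=
    Real.rpow_inv_rpow (by positivity) hp.ne'
  refine ⟨fun y => (l ^ (d : ℝ) / N) ^ p⁻¹ * u (x + l • y), hu.rescale x _ hl, ?_, ?_⟩
  · rw [integral_abs_rescale u x hc hl, hcp, ← hNdef]
    field_simp
  · rw [integral_norm_fderiv_rescale u x hc hl, hcp]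
    beta_reduce
    rw [smul_zero, add_zero, abs_mul, abs_of_pos hc, Real.mul_rpow hc.le (abs_nonneg _), hcp]
    field_simp

theorem energySet_nonempty {d : ℕ} {p v : ℝ} (hp : 0 < p) : (energySet d p v).Nonempty := by
  obtain ⟨u, hu, hu0⟩ := exists_smoothCS_apply_zero d
  exact ⟨_, rescaled_mem_energySet hp hu (x := 0) (by simp [hu0]) one_pos⟩

/-- The modulus of the ground state energy attached to a Sobolev constant `S`. -/
def energyBound (d : ℕ) (p v S : ℝ) : ℝ :=
  (p - d) / p * ((d : ℝ) / p) ^ ((d : ℝ) / (p - d)) * (S * v) ^ (p / (p - d))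

/-- Young's inequality in the form that links Sobolev constants to energies. -/
theorem neg_energyBound_le {d : ℕ} (hd : 1 ≤ d) {p v S G : ℝ} (hp : (d : ℝ) < p) (hv : 0 < v)
    (hS : 0 < S) (hG : 0 ≤ G) :
    -energyBound d p v S ≤ G - v * (S * G ^ ((d : ℝ) / p)) := by
  have hd0 : (0 : ℝ) < d := by exact_mod_cast hd
  have hp0 : 0 < p := hd0.trans hp
  have hpd : 0 < p - d := sub_pos.2 hp
  have hconj : (p / d).HolderConjugate (p / (p - d)) := by
    rw [Real.holderConjugate_iff]
    refine ⟨(one_lt_div hd0).2 hp, ?_⟩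
    field_simp
    ring
  have hy := Real.young_inequality_of_nonneg
    (a := (p / d * G) ^ ((d : ℝ) / p)) (b := (d / p) ^ ((d : ℝ) / p) * (S * v))
    (by positivity) (by positivity) hconj
  have h1 : ((p / d * G) ^ ((d : ℝ) / p)) ^ (p / d) / (p / d) = G := by
    rw [← Real.rpow_mul (by positivity), show (d : ℝ) / p * (p / d) = 1 by field_simp,
      Real.rpow_one]
    field_simp
  have h2 : ((d / p) ^ ((d : ℝ) / p) * (S * v)) ^ (p / (p - d)) / (p / (p - d)) =
      energyBound d p v S := by
    rw [Real.mul_rpow (by positivity) (by positivity), ← Real.rpow_mul (by positivity),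
      show (d : ℝ) / p * (p / (p - d)) = d / (p - d) by field_simp, energyBound]
    field_simp
  have h3 : (p / d * G) ^ ((d : ℝ) / p) * ((d / p) ^ ((d : ℝ) / p) * (S * v)) =
      v * (S * G ^ ((d : ℝ) / p)) := by
    have h4 : (p / d * G) ^ ((d : ℝ) / p) * (d / p) ^ ((d : ℝ) / p) = G ^ ((d : ℝ) / p) := by
      rw [← Real.mul_rpow (by positivity) (by positivity)]
      congr 1
      field_simp
    rw [← mul_assoc, h4]
    ring
  rw [h1, h2, h3] at hy
  linarith

theorem IsSobolevConst.neg_energyBound_mem_lowerBounds {d : ℕ} (hd : 1 ≤ d) {p v S : ℝ}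
    (hp : (d : ℝ) < p) (hv : 0 < v) (hS : IsSobolevConst d p S) :
    -energyBound d p v S ∈ lowerBounds (energySet d p v) := by
  rintro r ⟨u, hu, hN, rfl⟩
  have hp0 : 0 < p := (Nat.cast_nonneg d).trans_lt hp
  have h := hS u hu
  rw [hN, Real.one_rpow, mul_one] at h
  have h0 : |u 0| ^ p ≤ (⨆ x, |u x|) ^ p :=
    Real.rpow_le_rpow (abs_nonneg _) (le_ciSup hu.bddAbove_abs 0) hp0.le
  have hY := neg_energyBound_le hd hp hv hS.pos (integral_norm_fderiv_rpow_nonneg (p := p) u)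
  have := mul_le_mul_of_nonneg_left (h0.trans h) hv.le
  linarith

/-- A pointwise bound uniform over all dilations implies the scale-invariant bound. -/
theorem le_of_forall_dilation {d : ℕ} (hd : 1 ≤ d) {p v S G N M : ℝ} (hp : (d : ℝ) < p)
    (hv : 0 < v) (hS : 0 < S) (hG : 0 ≤ G) (hN : 0 < N) (hM : 0 < M)
    (h : ∀ l : ℝ, 0 < l → -energyBound d p v S ≤ (l ^ p * G - v * (l ^ (d : ℝ) * M)) / N) :
    M ≤ S * G ^ ((d : ℝ) / p) * N ^ ((p - d) / p) := by
  have hd0 : (0 : ℝ) < d := by exact_mod_cast hd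
  have hp0 : 0 < p := hd0.trans hp
  have hpd : 0 < p - d := sub_pos.2 hp
  set c := energyBound d p v S with hc
  have hc0 : 0 < c := by rw [hc, energyBound]; positivity
  rcases hG.eq_or_lt with rfl | hG
  · have hA : 0 < 2 * c * N / (v * M) := by positivity
    have h1 := h ((2 * c * N / (v * M)) ^ (d : ℝ)⁻¹) (by positivity)
    rw [Real.rpow_inv_rpow hA.le hd0.ne', le_div_iff₀ hN] at h1
    have h2 : v * (2 * c * N / (v * M) * M) = 2 * c * N := by field_simp
    rw [h2] at h1
    nlinarith [mul_pos hc0 hN]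
  · set q := p / (p - d) with hq
    set X := d / p * (S * v) with hX
    have hX0 : 0 < X := by positivity
    have hA : 0 < X ^ q * N / G := by positivity
    have h1 := h ((X ^ q * N / G) ^ p⁻¹) (by positivity)
    have hld : ((X ^ q * N / G) ^ p⁻¹) ^ (d : ℝ) =
        X ^ ((d : ℝ) / (p - d)) * N ^ ((d : ℝ) / p) / G ^ ((d : ℝ) / p) := by
      rw [← Real.rpow_mul hA.le, show p⁻¹ * (d : ℝ) = d / p by ring,
        Real.div_rpow (by positivity) hG.le, Real.mul_rpow (by positivity) hN.le,
        ← Real.rpow_mul hX0.le, show q * ((d : ℝ) / p) = d / (p - d) by rw [hq]; field_simp]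
    have hqd : q = (d : ℝ) / (p - d) + 1 := by rw [hq]; field_simp; ring
    have hXq : X ^ q = X ^ ((d : ℝ) / (p - d)) * X := by
      rw [hqd, Real.rpow_add hX0, Real.rpow_one]
    have hcX : c = (p - d) / p * (X ^ ((d : ℝ) / (p - d)) * (S * v)) := by
      rw [hc, energyBound, ← hq, hqd, Real.rpow_add (by positivity), Real.rpow_one, hX,
        Real.mul_rpow (x := d / p) (y := S * v) (by positivity) (by positivity)]
      ring
    have hNN : N = N ^ ((d : ℝ) / p) * N ^ ((p - d) / p) := by
      rw [← Real.rpow_add hN, show (d : ℝ) / p + (p - d) / p = 1 by field_simp; ring,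
        Real.rpow_one]
    rw [Real.rpow_inv_rpow hA.le hp0.ne', hld, le_div_iff₀ hN, div_mul_cancel₀ _ hG.ne',
      hcX, hXq] at h1
    set Y := X ^ ((d : ℝ) / (p - d))
    have hY : 0 < Y := by positivity
    set g := G ^ ((d : ℝ) / p)
    have hg : 0 < g := by positivity
    set n := N ^ ((d : ℝ) / p)
    have hn : 0 < n := by positivity
    set m := N ^ ((p - d) / p)
    have h2 : v * (Y * n / g * M) ≤ Y * (S * v) * N := by
      have : Y * X * N + (p - d) / p * (Y * (S * v)) * N = Y * (S * v) * N := by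
        rw [hX]; field_simp; ring
      linarith
    rw [hNN] at h2
    have h3 : v * Y * n / g * M ≤ v * Y * n / g * (S * g * m) := by
      calc v * Y * n / g * M = v * (Y * n / g * M) := by ring
        _ ≤ Y * (S * v) * (n * m) := h2
        _ = v * Y * n / g * (S * g * m) := by field_simp
    exact le_of_mul_le_mul_left h3 (by positivity)

theorem isSobolevConst_of_mem_lowerBounds {d : ℕ} (hd : 1 ≤ d) {p v S : ℝ} (hp : (d : ℝ) < p)
    (hv : 0 < v) (hS : 0 < S) (h : -energyBound d p v S ∈ lowerBounds (energySet d p v)) :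
    IsSobolevConst d p S := by
  intro u hu
  have hp0 : 0 < p := (Nat.cast_nonneg d).trans_lt hp
  have hR : 0 ≤ S * (∫ x, ‖fderiv ℝ u x‖ ^ p) ^ ((d : ℝ) / p) *
      (∫ x, |u x| ^ p) ^ ((p - d) / p) :=
    mul_nonneg (mul_nonneg hS.le (Real.rpow_nonneg (integral_norm_fderiv_rpow_nonneg u) _))
      (Real.rpow_nonneg (integral_abs_rpow_nonneg u) _)
  rw [← Real.le_rpow_inv_iff_of_pos (Real.iSup_nonneg fun _ => abs_nonneg _) hR hp0]
  refine ciSup_le fun x => ?_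
  rw [Real.le_rpow_inv_iff_of_pos (abs_nonneg _) hR hp0]
  by_cases hx : u x = 0
  · rwa [hx, abs_zero, Real.zero_rpow hp0.ne']
  · exact le_of_forall_dilation hd hp hv hS (integral_norm_fderiv_rpow_nonneg u)
      (hu.integral_abs_rpow_pos hp0 hx) (by positivity)
      fun l hl => h (rescaled_mem_energySet hp0 hu hx hl)

theorem exists_energyBound_eq {d : ℕ} (hd : 1 ≤ d) {p v c : ℝ} (hp : (d : ℝ) < p) (hv : 0 < v)
    (hc : 0 < c) : ∃ S, 0 < S ∧ energyBound d p v S = c := by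
  have hd0 : (0 : ℝ) < d := by exact_mod_cast hd
  have hp0 : 0 < p := hd0.trans hp
  have hpd : 0 < p - d := sub_pos.2 hp
  set K := (p - d) / p * ((d : ℝ) / p) ^ ((d : ℝ) / (p - d)) with hK
  have hK0 : 0 < K := by positivity
  refine ⟨(c / K) ^ (p / (p - d))⁻¹ / v, by positivity, ?_⟩
  rw [energyBound, ← hK, div_mul_cancel₀ _ hv.ne',
    Real.rpow_inv_rpow (by positivity) (by positivity)]
  field_simp

theorem lt_of_energyBound_lt {d : ℕ} {p v S T : ℝ} (hp : (d : ℝ) < p) (hv : 0 < v)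
    (hT : 0 ≤ T) (h : energyBound d p v S < energyBound d p v T) : S < T := by
  by_contra! hTS
  have hpd : 0 < p - d := sub_pos.2 hp
  have hp0 : 0 < p := (Nat.cast_nonneg d).trans_lt hp
  refine h.not_ge (mul_le_mul_of_nonneg_left ?_ (by positivity))
  exact Real.rpow_le_rpow (by positivity) (by gcongr) (by positivity)

theorem isSobolevConst_sobolevSharp {d : ℕ} {p : ℝ} (h : ∃ S, IsSobolevConst d p S) :
    IsSobolevConst d p (SobolevSharp d p) := by
  intro u hu
  have hA : 0 ≤ (∫ x, ‖fderiv ℝ u x‖ ^ p) ^ ((d : ℝ) / p) * (∫ x, |u x| ^ p) ^ ((p - d) / p) :=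
    mul_nonneg (Real.rpow_nonneg (integral_norm_fderiv_rpow_nonneg u) _)
      (Real.rpow_nonneg (integral_abs_rpow_nonneg u) _)
  rw [mul_assoc]
  rcases hA.eq_or_lt with hA | hA
  · obtain ⟨S, hS⟩ := h
    have := hS u hu
    rw [mul_assoc, ← hA, mul_zero] at this
    rwa [← hA, mul_zero]
  · rw [← div_le_iff₀ hA]
    refine le_csInf h fun S hS => ?_
    rw [div_le_iff₀ hA, ← mul_assoc]
    exact hS u hu

theorem Efun_eq_neg_energyBound {d : ℕ} (hd : 1 ≤ d) {p v : ℝ} (hp : (d : ℝ) < p) (hv : 0 < v) :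
    Efun d p v = -energyBound d p v (SobolevSharp d p) := by
  have hp0 : 0 < p := (Nat.cast_nonneg d).trans_lt hp
  have hpd : 0 < p - d := sub_pos.2 hp
  have hne := energySet_nonempty (d := d) (v := v) hp0
  change sInf (energySet d p v) = _
  by_cases hex : ∃ S, IsSobolevConst d p S
  · have hsharp := isSobolevConst_sobolevSharp hex
    have hlow := hsharp.neg_energyBound_mem_lowerBounds hd hp hv
    refine le_antisymm ?_ (le_csInf hne hlow)
    by_contra! hlt
    have hd0 : (0 : ℝ) < d := by exact_mod_cast hd
    have hpos : 0 < energyBound d p v (SobolevSharp d p) := by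
      have := hsharp.pos
      rw [energyBound]
      positivity
    set m := sInf (energySet d p v) with hm
    obtain ⟨S, hS, hSc⟩ := exists_energyBound_eq hd hp hv
      (lt_max_of_lt_right (half_pos hpos) :
        0 < max (-m) (energyBound d p v (SobolevSharp d p) / 2))
    have hSlt : S < SobolevSharp d p := by
      refine lt_of_energyBound_lt hp hv hsharp.pos.le ?_
      rw [hSc]
      exact max_lt (by linarith) (half_lt_self hpos)
    have hSob : IsSobolevConst d p S := by
      refine isSobolevConst_of_mem_lowerBounds hd hp hv hS fun r hr => ?_
      have h1 : m ≤ r := csInf_le ⟨_, hlow⟩ hr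
      have h2 := le_max_left (-m) (energyBound d p v (SobolevSharp d p) / 2)
      rw [hSc]
      linarith
    exact hSlt.not_ge (csInf_le ⟨0, fun T hT => (IsSobolevConst.pos hT).le⟩ hSob)
  · have hzero : SobolevSharp d p = 0 := by
      have hempty : {S : ℝ | IsSobolevConst d p S} = ∅ :=
        Set.eq_empty_iff_forall_notMem.2 fun S hS => hex ⟨S, hS⟩
      change sInf {S : ℝ | IsSobolevConst d p S} = 0
      rw [hempty, Real.sInf_empty]
    have hunbdd : ¬ BddBelow (energySet d p v) := by
      rintro ⟨b, hb⟩
      obtain ⟨S, hS, hSc⟩ := exists_energyBound_eq hd hp hv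
        (lt_max_of_lt_right one_pos : 0 < max (-b) 1)
      refine hex ⟨S, isSobolevConst_of_mem_lowerBounds hd hp hv hS fun r hr => ?_⟩
      have h1 := hb hr
      have h2 := le_max_left (-b) 1
      rw [hSc]
      linarith
    rw [Real.sInf_of_not_bddBelow hunbdd, hzero, energyBound, zero_mul,
      Real.zero_rpow (div_pos hp0 hpd).ne', mul_zero, neg_zero]

/-- Value of E(v) in terms of the sharp Sobolev interpolation constant. -/
theorem stmt2 (d : ℕ) (hd : 1 ≤ d) (p : ℝ) (hp : (d : ℝ) < p) (v : ℝ) (hv : 0 < v) :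
    Efun d p v = -((p - d) / p) * ((d : ℝ) / p) ^ ((d : ℝ) / (p - d)) *
      (SobolevSharp d p * v) ^ (p / (p - d)) := by
  rw [Efun_eq_neg_energyBound hd hp hv, energyBound]
  ring
end
end

section
/- For every real p > 1, the sharp constant in the one-dimensional Sobolev interpolation inequality equals p/2; that is, the smallest constant S such that ‖u‖_∞^p ≤ S · ‖u'‖_p · ‖u‖_p^{p-1} holds for all smooth compactly supported u : ℝ → ℝ is S_{1,p} = p/2. -/
open MeasureTheory Filter Metric

noncomputable section

/-- The one-dimensional Sobolev interpolation inequality with constant `p / 2`. -/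
theorem abs_rpow_le_half_mul_integral_rpow {p : ℝ} (hp : 1 < p) {v : ℝ → ℝ}
    (hv : ContDiff ℝ 1 v) (hc : HasCompactSupport v) (x : ℝ) :
    |v x| ^ p ≤ p / 2 * (∫ t, |deriv v t| ^ p) ^ (1 / p) *
      (∫ t, |v t| ^ p) ^ ((p - 1) / p) := by
  have hp0 : 0 < p := by linarith
  set F : ℝ → ℝ := fun t ↦ |v t| ^ p with hF
  have hF1 : ContDiff ℝ 1 F := by simpa [hF] using hv.norm_rpow hp
  have hFc : HasCompactSupport F :=
    hc.comp_left (g := fun s : ℝ ↦ |s| ^ p) (by simp [hp0.ne'])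
  have hFint : Integrable (deriv F) :=
    (hF1.continuous_deriv le_rfl).integrable_of_hasCompactSupport hFc.deriv
  have hderiv : ∀ t, |deriv F t| = p * (|deriv v t| * |v t| ^ (p - 1)) := by
    intro t
    have h : HasDerivAt F (p * |v t| ^ (p - 2) * v t * deriv v t) t :=
      (hasDerivAt_abs_rpow (v t) hp).comp t
        ((hv.differentiable one_ne_zero) t).hasDerivAt
    have hpow : |v t| ^ (p - 2) * |v t| = |v t| ^ (p - 1) := by
      rcases eq_or_ne (v t) 0 with h0 | h0
      · simp [h0, Real.zero_rpow (by linarith : p - 1 ≠ 0)]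
      · rw [← Real.rpow_add_one (abs_ne_zero.2 h0)]
        congr 1; ring
    rw [h.deriv, abs_mul, abs_mul, abs_mul, abs_of_pos hp0,
      abs_of_nonneg (Real.rpow_nonneg (abs_nonneg (v t)) _), mul_assoc p, hpow]
    ring
  have htwo : 2 * F x ≤ ∫ t, |deriv F t| := by
    rw [← intervalIntegral.integral_Iic_add_Ioi hFint.abs.integrableOn
      hFint.abs.integrableOn (b := x)]
    have h1 : F x ≤ ∫ t in Set.Iic x, |deriv F t| := by
      rw [← hFc.integral_Iic_deriv_eq hF1 x]
      exact (le_abs_self _).trans (abs_integral_le_integral_abs)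
    have h2 : F x ≤ ∫ t in Set.Ioi x, |deriv F t| := by
      have := hFc.integral_Ioi_deriv_eq hF1 x
      have h3 : F x = -∫ t in Set.Ioi x, deriv F t := by rw [this]; ring
      rw [h3]
      exact (neg_le_abs _).trans (abs_integral_le_integral_abs)
    linarith
  have hpq : p.HolderConjugate (p / (p - 1)) := Real.HolderConjugate.conjExponent hp
  have hcont : Continuous fun t ↦ |v t| ^ (p - 1) :=
    hv.continuous.abs.rpow_const fun _ ↦ Or.inr (by linarith)
  have hholder := integral_mul_le_Lp_mul_Lq_of_nonneg (μ := volume) hpq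
    (f := fun t ↦ |deriv v t|) (g := fun t ↦ |v t| ^ (p - 1))
    (Eventually.of_forall fun _ ↦ abs_nonneg _)
    (Eventually.of_forall fun _ ↦ Real.rpow_nonneg (abs_nonneg _) _)
    ((hv.continuous_deriv le_rfl).abs.memLp_of_hasCompactSupport
      (hc.deriv.comp_left (g := fun s : ℝ ↦ |s|) abs_zero))
    (hcont.memLp_of_hasCompactSupport
      (hc.comp_left (g := fun s : ℝ ↦ |s| ^ (p - 1))
        (by simp [Real.zero_rpow (by linarith : p - 1 ≠ 0)])))
  have hexp : ∀ t, (|v t| ^ (p - 1)) ^ (p / (p - 1)) = |v t| ^ p := by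
    intro t
    rw [← Real.rpow_mul (abs_nonneg _), mul_div_cancel₀ _ (by linarith : p - 1 ≠ 0)]
  simp only [hexp, one_div_div] at hholder
  simp only [hderiv, integral_const_mul] at htwo
  have := mul_le_mul_of_nonneg_left hholder hp0.le
  change F x ≤ _
  linarith

theorem integral_exp_neg_mul_abs {p : ℝ} (hp : 0 < p) :
    ∫ x : ℝ, Real.exp (-p * |x|) = 2 / p := by
  rw [integral_comp_abs (f := fun x ↦ Real.exp (-p * x)),
    integral_exp_mul_Ioi (by linarith : -p < 0)]
  simp [div_eq_mul_inv]

/-- If `|f x| ≤ A * exp (-|x|)` for all `x`, then `‖f‖_p^p ≤ A ^ p * (2 / p)`. -/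
theorem integral_abs_rpow_le_of_le_exp {p A : ℝ} (hp : 0 < p) (hA : 0 ≤ A) {f : ℝ → ℝ}
    (hf : ∀ x, |f x| ≤ A * Real.exp (-|x|)) :
    ∫ x, |f x| ^ p ≤ A ^ p * (2 / p) := by
  have hint : Integrable fun x : ℝ ↦ Real.exp (-p * |x|) := by
    refine Integrable.of_integral_ne_zero ?_
    rw [integral_exp_neg_mul_abs hp]
    positivity
  rw [← integral_exp_neg_mul_abs hp, ← integral_const_mul]
  refine integral_mono_of_nonneg (Eventually.of_forall fun x ↦ by positivity)
    (hint.const_mul _) (Eventually.of_forall fun x ↦ ?_)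
  calc |f x| ^ p ≤ (A * Real.exp (-|x|)) ^ p := by gcongr; exact hf x
    _ = A ^ p * Real.exp (-p * |x|) := by
      rw [Real.mul_rpow hA (Real.exp_pos _).le, ← Real.exp_mul]
      congr 2; ring

/-- Smooth compactly supported functions approximating the extremal `exp (-|x|)`. -/
theorem exists_approx_exp_neg_abs :
    ∃ C : ℝ, 0 ≤ C ∧ ∀ ε : ℝ, 0 < ε → ∃ v : ℝ → ℝ, ContDiff ℝ (⊤ : ℕ∞) v ∧
      HasCompactSupport v ∧ v 0 = Real.exp (-ε) ∧ (∀ x, |v x| ≤ 1 * Real.exp (-|x|)) ∧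
      ∀ x, |deriv v x| ≤ (1 + C * ε) * Real.exp (-|x|) := by
  let φ : ContDiffBump (0 : ℝ) := default
  have hφ : ContDiff ℝ (⊤ : ℕ∞) φ := φ.contDiff
  obtain ⟨C, hC⟩ := (hφ.continuous_deriv (by simp)).bounded_above_of_compact_support
    φ.hasCompactSupport.deriv
  refine ⟨C, (norm_nonneg _).trans (hC 0), fun ε hε ↦ ?_⟩
  have hpos : ∀ x : ℝ, 0 < x ^ 2 + ε ^ 2 := fun x ↦ by positivity
  have hsq : ∀ x : ℝ, |x| ≤ √(x ^ 2 + ε ^ 2) := fun x ↦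
    Real.abs_le_sqrt (by nlinarith [sq_nonneg ε])
  have hg : ∀ x : ℝ, Real.exp (-√(x ^ 2 + ε ^ 2)) ≤ Real.exp (-|x|) := fun x ↦
    Real.exp_le_exp.2 (neg_le_neg (hsq x))
  have hφ1 : ∀ y, |φ y| ≤ 1 := fun y ↦ by rw [abs_of_nonneg φ.nonneg]; exact φ.le_one
  refine ⟨fun x ↦ φ (ε * x) * Real.exp (-√(x ^ 2 + ε ^ 2)), ?_, ?_, ?_, fun x ↦ ?_,
    fun x ↦ ?_⟩
  · refine (hφ.comp (contDiff_const.mul contDiff_id)).mul (Real.contDiff_exp.comp ?_)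
    exact (((contDiff_id.pow 2).add contDiff_const).sqrt fun x ↦ (hpos x).ne').neg
  · refine HasCompactSupport.mul_right ?_
    exact φ.hasCompactSupport.comp_homeomorph (Homeomorph.mulLeft₀ ε hε.ne')
  · have : φ 0 = 1 := φ.one_of_mem_closedBall (by simp [φ.rIn_pos.le])
    simp [this, Real.sqrt_sq hε.le]
  · rw [abs_mul, Real.abs_exp]
    exact mul_le_mul (hφ1 _) (hg x) (Real.exp_pos _).le zero_le_one
  · have hs : HasDerivAt (fun x : ℝ ↦ √(x ^ 2 + ε ^ 2))
        (x / √(x ^ 2 + ε ^ 2)) x := by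
      have h := (((hasDerivAt_id x).pow 2).add_const (ε ^ 2)).sqrt (hpos x).ne'
      refine h.congr_deriv ?_
      change ((2 : ℕ) : ℝ) * x ^ (2 - 1) * 1 / (2 * √(x ^ 2 + ε ^ 2)) = _
      simp [mul_div_mul_left]
    have hd : HasDerivAt (fun x ↦ φ (ε * x)) (deriv φ (ε * x) * ε) x := by
      have h1 := ((hφ.differentiable (by simp)) (ε * x)).hasDerivAt
      exact h1.comp x (by simpa using (hasDerivAt_id x).const_mul ε)
    have hv : HasDerivAt (fun x ↦ φ (ε * x) * Real.exp (-√(x ^ 2 + ε ^ 2)))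
        (deriv φ (ε * x) * ε * Real.exp (-√(x ^ 2 + ε ^ 2)) +
          φ (ε * x) * (Real.exp (-√(x ^ 2 + ε ^ 2)) * -(x / √(x ^ 2 + ε ^ 2)))) x :=
      hd.mul hs.neg.exp
    rw [hv.deriv]
    have hr : |x / √(x ^ 2 + ε ^ 2)| ≤ 1 := by
      rw [abs_div, abs_of_nonneg (Real.sqrt_nonneg _)]
      exact div_le_one_of_le₀ (hsq x) (Real.sqrt_nonneg _)
    have hC' : |deriv φ (ε * x)| ≤ C := hC _
    set g := Real.exp (-√(x ^ 2 + ε ^ 2))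
    have hg0 : 0 ≤ g := (Real.exp_pos _).le
    have hC0 : 0 ≤ C := (abs_nonneg _).trans hC'
    calc |deriv φ (ε * x) * ε * g + φ (ε * x) * (g * -(x / √(x ^ 2 + ε ^ 2)))|
        ≤ |deriv φ (ε * x)| * ε * g + |φ (ε * x)| * (g * |x / √(x ^ 2 + ε ^ 2)|) := by
          refine (abs_add_le _ _).trans_eq ?_
          simp only [abs_mul, abs_neg, abs_of_pos hε, abs_of_nonneg hg0]
      _ ≤ C * ε * g + 1 * (g * 1) := by
          gcongr
          exact hφ1 _
      _ = (1 + C * ε) * g := by ring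
      _ ≤ (1 + C * ε) * Real.exp (-|x|) := by
          gcongr
          exact hg x

/-- The constant `p / 2` in the one-dimensional interpolation inequality is optimal. -/
theorem half_le_of_interpolation {p S : ℝ} (hp : 1 < p)
    (hS : ∀ v : ℝ → ℝ, ContDiff ℝ (⊤ : ℕ∞) v → HasCompactSupport v →
      (⨆ x, |v x|) ^ p ≤ S * (∫ x, |deriv v x| ^ p) ^ (1 / p) *
        (∫ x, |v x| ^ p) ^ ((p - 1) / p)) : p / 2 ≤ S := by
  have hp0 : 0 < p := by linarith
  obtain ⟨C, hC, happrox⟩ := exists_approx_exp_neg_abs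
  have key : ∀ ε : ℝ, 0 < ε → Real.exp (-ε) ^ p ≤ S * ((1 + C * ε) * (2 / p)) := by
    intro ε hε
    obtain ⟨v, hv, hc, h0, hb, hd⟩ := happrox ε hε
    have hA : 0 ≤ 1 + C * ε := by positivity
    have hI := integral_abs_rpow_le_of_le_exp hp0 hA hd
    have hJ := integral_abs_rpow_le_of_le_exp hp0 zero_le_one hb
    have hsup : Real.exp (-ε) ≤ ⨆ x, |v x| := by
      have hbdd : BddAbove (Set.range fun x ↦ |v x|) := by
        refine ⟨1, ?_⟩
        rintro _ ⟨x, rfl⟩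
        refine (hb x).trans ?_
        simp
      have := le_ciSup hbdd 0
      rwa [h0, Real.abs_exp] at this
    have h1 : Real.exp (-ε) ^ p ≤ S * ((∫ x, |deriv v x| ^ p) ^ (1 / p) *
        (∫ x, |v x| ^ p) ^ ((p - 1) / p)) := by
      rw [← mul_assoc]
      refine le_trans ?_ (hS v hv hc)
      gcongr
    have hI0 : 0 ≤ ∫ x, |deriv v x| ^ p := integral_nonneg fun x ↦ by positivity
    have hJ0 : 0 ≤ ∫ x, |v x| ^ p := integral_nonneg fun x ↦ by positivity
    have hS0 : 0 ≤ S := by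
      by_contra! hneg
      have : 0 < Real.exp (-ε) ^ p := by positivity
      have : S * ((∫ x, |deriv v x| ^ p) ^ (1 / p) *
        (∫ x, |v x| ^ p) ^ ((p - 1) / p)) ≤ 0 :=
        mul_nonpos_of_nonpos_of_nonneg hneg.le (by positivity)
      linarith
    refine h1.trans (mul_le_mul_of_nonneg_left ?_ hS0)
    calc (∫ x, |deriv v x| ^ p) ^ (1 / p) * (∫ x, |v x| ^ p) ^ ((p - 1) / p)
        ≤ ((1 + C * ε) ^ p * (2 / p)) ^ (1 / p) * (1 ^ p * (2 / p)) ^ ((p - 1) / p) := by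
          have : 0 ≤ (p - 1) / p := div_nonneg (by linarith) hp0.le
          gcongr
      _ = (1 + C * ε) * (2 / p) := by
          rw [Real.mul_rpow (by positivity) (by positivity), ← Real.rpow_mul hA,
            mul_one_div_cancel hp0.ne', Real.rpow_one, Real.one_rpow, one_mul, mul_assoc,
            ← Real.rpow_add (by positivity), ← add_div, add_sub_cancel, div_self hp0.ne',
            Real.rpow_one]
  have hl : Tendsto (fun ε : ℝ ↦ Real.exp (-ε) ^ p) (nhdsWithin 0 (Set.Ioi 0)) (nhds 1) := by
    have : Continuous fun ε : ℝ ↦ Real.exp (-ε) ^ p :=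
      (Real.continuous_exp.comp continuous_neg).rpow_const fun _ ↦ Or.inr hp0.le
    simpa using (this.tendsto 0).mono_left nhdsWithin_le_nhds
  have hr : Tendsto (fun ε : ℝ ↦ S * ((1 + C * ε) * (2 / p))) (nhdsWithin 0 (Set.Ioi 0))
      (nhds (S * (2 / p))) := by
    have : Continuous fun ε : ℝ ↦ S * ((1 + C * ε) * (2 / p)) := by fun_prop
    simpa using (this.tendsto 0).mono_left nhdsWithin_le_nhds
  have hlim : 1 ≤ S * (2 / p) :=
    le_of_tendsto_of_tendsto hl hr (eventually_mem_nhdsWithin.mono key)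
  rw [← mul_div_assoc, one_le_div hp0] at hlim
  linarith

/-- The canonical isometry between `ℝ` and one-dimensional Euclidean space. -/
def realIsometryRdOne : ℝ ≃ₗᵢ[ℝ] Rd 1 :=
  (OrthonormalBasis.singleton (Fin 1) ℝ).repr

theorem integral_comp_realIsometryRdOne (f : Rd 1 → ℝ) :
    ∫ x, f (realIsometryRdOne x) = ∫ y, f y :=
  (OrthonormalBasis.singleton (Fin 1) ℝ).measurePreserving_repr.integral_comp
    realIsometryRdOne.toHomeomorph.measurableEmbedding f

theorem norm_fderiv_realIsometryRdOne (u : Rd 1 → ℝ) (x : ℝ) :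
    ‖fderiv ℝ u (realIsometryRdOne x)‖ = |deriv (u ∘ realIsometryRdOne) x| := by
  rw [← Real.norm_eq_abs, norm_deriv_eq_norm_fderiv]
  have h := realIsometryRdOne.toContinuousLinearEquiv.comp_right_fderiv (f := u) (x := x)
  simp only [LinearIsometryEquiv.coe_toContinuousLinearEquiv] at h
  rw [h]
  exact (ContinuousLinearMap.opNorm_comp_linearIsometryEquiv _ realIsometryRdOne).symm

/-- On the line, the interpolation inequality over `Rd 1` can be tested on functions on `ℝ`. -/
theorem interpolation_rdOne_iff (p S : ℝ) :
    (∀ u : Rd 1 → ℝ, SmoothCS 1 u →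
      (⨆ x, |u x|) ^ p ≤ S * (∫ x, ‖fderiv ℝ u x‖ ^ p) ^ (((1 : ℕ) : ℝ) / p) *
        (∫ x, |u x| ^ p) ^ ((p - (1 : ℕ)) / p)) ↔
    ∀ v : ℝ → ℝ, ContDiff ℝ (⊤ : ℕ∞) v → HasCompactSupport v →
      (⨆ x, |v x|) ^ p ≤ S * (∫ x, |deriv v x| ^ p) ^ (1 / p) *
        (∫ x, |v x| ^ p) ^ ((p - 1) / p) := by
  let e := realIsometryRdOne
  have htrans : ∀ u : Rd 1 → ℝ,
      (⨆ x, |u x|) = (⨆ x, |(u ∘ e) x|) ∧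
      ∫ x, ‖fderiv ℝ u x‖ ^ p = ∫ x, |deriv (u ∘ e) x| ^ p ∧
      ∫ x, |u x| ^ p = ∫ x, |(u ∘ e) x| ^ p := by
    intro u
    refine ⟨(e.surjective.iSup_comp fun y ↦ |u y|).symm, ?_,
      (integral_comp_realIsometryRdOne fun y ↦ |u y| ^ p).symm⟩
    rw [← integral_comp_realIsometryRdOne]
    simp only [norm_fderiv_realIsometryRdOne, e]
  constructor
  · intro h v hv hc
    have hu : SmoothCS 1 (v ∘ e.symm) :=
      ⟨hv.comp e.symm.contDiff, hc.comp_homeomorph e.symm.toHomeomorph⟩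
    obtain ⟨h1, h2, h3⟩ := htrans (v ∘ e.symm)
    have hve : (v ∘ e.symm) ∘ e = v := by ext x; simp
    have := h _ hu
    rwa [h1, h2, h3, hve, Nat.cast_one] at this
  · intro h u hu
    obtain ⟨h1, h2, h3⟩ := htrans u
    rw [h1, h2, h3, Nat.cast_one]
    exact h _ (hu.1.comp e.contDiff) (hu.2.comp_homeomorph e.toHomeomorph)

/-- The sharp one-dimensional Sobolev interpolation constant equals p/2. -/
theorem stmt4 (p : ℝ) (hp : 1 < p) : SobolevSharp 1 p = p / 2 := by
  have hp0 : 0 < p := by linarith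
  refine IsLeast.csInf_eq ⟨?_, ?_⟩
  · refine (interpolation_rdOne_iff p (p / 2)).2 fun v hv hc ↦ ?_
    have hle := abs_rpow_le_half_mul_integral_rpow hp (hv.of_le (by simp)) hc
    have hR := (Real.rpow_nonneg (abs_nonneg (v 0)) p).trans (hle 0)
    refine (Real.le_rpow_inv_iff_of_pos (Real.iSup_nonneg fun x ↦ abs_nonneg _) hR hp0).1 ?_
    exact ciSup_le fun x ↦ (Real.le_rpow_inv_iff_of_pos (abs_nonneg _) hR hp0).2 (hle x)
  · intro S hS
    exact half_le_of_interpolation hp ((interpolation_rdOne_iff p S).1 hS)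
end
end

section
/- Let d ≥ 1 be an integer, p > d a real exponent, and V ∈ L^1(ℝ^d). Then for every smooth compactly supported u : ℝ^d → ℝ, ∫_{ℝ^d} (|∇u|^p − V|u|^p) dx ≥ -((p-d)/p) · (d/p)^{d/(p-d)} · (S_{d,p} ∫_{ℝ^d} V_+ dx)^{p/(p-d)} · ∫_{ℝ^d} |u|^p dx, where V_+ = max(V,0). -/
open MeasureTheory Filter Metric

noncomputable section

/-- A function on `[0, R]` whose derivative is at most `K t ^ (-a)` with `a < 1` has increment at
most `K R ^ (1 - a) / (1 - a)`. -/
lemma sub_le_of_deriv_ge_rpow {f f' : ℝ → ℝ} {K a R : ℝ} (ha : a < 1) (hR : 0 ≤ R)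
    (hf : ∀ t, HasDerivAt f (f' t) t) (hb : ∀ t, 0 < t → -(K * t ^ (-a)) ≤ f' t) :
    f 0 - f R ≤ K * (R ^ (1 - a) / (1 - a)) := by
  have ha' : 0 < 1 - a := by linarith
  have hmono : MonotoneOn (fun t => f t + K * (t ^ (1 - a) / (1 - a))) (Set.Icc 0 R) := by
    apply monotoneOn_of_hasDerivWithinAt_nonneg (f' := fun t => f' t + K * t ^ (-a))
      (convex_Icc 0 R)
    · have hfc : Continuous f := continuous_iff_continuousAt.2 fun t => (hf t).continuousAt
      have hr : Continuous fun t : ℝ => t ^ (1 - a) := Real.continuous_rpow_const ha'.le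
      fun_prop
    · intro t ht
      rw [interior_Icc] at ht
      have h := ((Real.hasDerivAt_rpow_const (p := 1 - a) (Or.inl ht.1.ne')).div_const
        (1 - a)).const_mul K
      refine ((hf t).add (h.congr_deriv ?_)).hasDerivWithinAt
      rw [mul_div_cancel_left₀ _ ha'.ne']
      ring_nf
    · intro t ht
      rw [interior_Icc] at ht
      linarith [hb t ht.1]
  have h := hmono (Set.left_mem_Icc.2 hR) (Set.right_mem_Icc.2 hR) hR
  simp only [Real.zero_rpow ha'.ne', zero_div, mul_zero, add_zero] at h
  linarith

/-- Hölder's inequality and scaling: the average of `g` over a ball of radius `t`. -/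
lemma setIntegral_closedBall_comp_smul_le {d : ℕ} {p : ℝ} (hp : 1 < p) {g : Rd d → ℝ}
    (hg : Continuous g) (hgc : HasCompactSupport g) (hg0 : ∀ y, 0 ≤ g y) (x : Rd d)
    {t : ℝ} (ht : 0 < t) :
    ∫ y in closedBall (0 : Rd d) 1, g (x + t • y) ≤
      volume.real (closedBall (0 : Rd d) 1) ^ (1 - 1 / p) *
        (∫ y, g y ^ p) ^ (1 / p) * t ^ (-(d / p)) := by
  have hp0 : 0 < p := by linarith
  have hpq := Real.HolderConjugate.conjExponent hp
  set q := p.conjExponent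
  have hq : 1 / q = 1 - 1 / p := by
    have := hpq.inv_add_inv_eq_one
    simp only [one_div]
    linarith
  have hcont : Continuous fun y => g (x + t • y) := by fun_prop
  have hfin : IsFiniteMeasure (volume.restrict (closedBall (0 : Rd d) 1)) :=
    ⟨by simpa using (isCompact_closedBall (0 : Rd d) 1).measure_lt_top⟩
  have hmem : MemLp (fun y => g (x + t • y)) (ENNReal.ofReal p)
      (volume.restrict (closedBall (0 : Rd d) 1)) := by
    obtain ⟨C, hC⟩ := hgc.exists_bound_of_continuous hg
    exact MemLp.of_bound hcont.aestronglyMeasurable C (ae_of_all _ fun y => hC _)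
  have hholder := integral_mul_le_Lp_mul_Lq_of_nonneg
    (μ := volume.restrict (closedBall (0 : Rd d) 1)) hpq
    (ae_of_all _ fun y => hg0 (x + t • y)) (g := fun _ => (1 : ℝ))
    (ae_of_all _ fun y => zero_le_one) hmem (memLp_const 1)
  simp only [mul_one, Real.one_rpow, integral_const, smul_eq_mul, measureReal_restrict_apply_univ,
    hq] at hholder
  have hgp : Continuous fun y => g y ^ p := hg.rpow_const fun y => Or.inr hp0.le
  have hgpc : HasCompactSupport fun y => g y ^ p :=
    hgc.comp_left (g := fun s : ℝ => s ^ p) (Real.zero_rpow hp0.ne')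
  have hint : Integrable fun y => g y ^ p := hgp.integrable_of_hasCompactSupport hgpc
  have hint' : Integrable fun y => g (x + t • y) ^ p :=
    (hint.comp_add_left x).comp_smul ht.ne'
  have hscale : ∫ y, g (x + t • y) ^ p = (t ^ d)⁻¹ * ∫ y, g y ^ p := by
    rw [Measure.integral_comp_smul volume (fun y => g (x + y) ^ p) t,
      integral_add_left_eq_self (fun y => g y ^ p) x, finrank_euclideanSpace_fin,
      abs_of_pos (by positivity), smul_eq_mul]
  have hI : 0 ≤ ∫ y, g y ^ p := integral_nonneg fun y => Real.rpow_nonneg (hg0 y) p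
  have hset : ∫ y in closedBall (0 : Rd d) 1, g (x + t • y) ^ p ≤ (t ^ d)⁻¹ * ∫ y, g y ^ p :=
    hscale ▸ setIntegral_le_integral hint' (ae_of_all _ fun y => Real.rpow_nonneg (hg0 _) p)
  have hpow : ((t ^ d)⁻¹ * ∫ y, g y ^ p) ^ (1 / p) =
      t ^ (-(d / p)) * (∫ y, g y ^ p) ^ (1 / p) := by
    rw [Real.mul_rpow (by positivity) hI, ← Real.rpow_natCast, ← Real.rpow_neg ht.le,
      ← Real.rpow_mul ht.le]
    congr 2
    ring
  calc ∫ y in closedBall (0 : Rd d) 1, g (x + t • y)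
      ≤ (∫ y in closedBall (0 : Rd d) 1, g (x + t • y) ^ p) ^ (1 / p) *
        volume.real (closedBall (0 : Rd d) 1) ^ (1 - 1 / p) := hholder
    _ ≤ ((t ^ d)⁻¹ * ∫ y, g y ^ p) ^ (1 / p) *
        volume.real (closedBall (0 : Rd d) 1) ^ (1 - 1 / p) := by
      gcongr
      exact integral_nonneg fun y => Real.rpow_nonneg (hg0 _) p
    _ = _ := by rw [hpow]; ring

lemma hasDerivAt_setIntegral_closedBall_comp_smul {d : ℕ} {u : Rd d → ℝ}
    (hu : SmoothCS d u) (x : Rd d) (t : ℝ) :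
    HasDerivAt (fun t : ℝ => ∫ y in closedBall (0 : Rd d) 1, u (x + t • y))
      (∫ y in closedBall (0 : Rd d) 1, fderiv ℝ u (x + t • y) y) t := by
  have hcu : Continuous u := hu.1.continuous
  have hcd : Continuous (fderiv ℝ u) := hu.1.continuous_fderiv (by simp)
  have hfin : IsFiniteMeasure (volume.restrict (closedBall (0 : Rd d) 1)) :=
    ⟨by simpa using (isCompact_closedBall (0 : Rd d) 1).measure_lt_top⟩
  obtain ⟨C, hC⟩ := (hu.2.fderiv ℝ).exists_bound_of_continuous hcd
  refine (hasDerivAt_integral_of_dominated_loc_of_deriv_le (bound := fun _ => C)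
    (F := fun (t : ℝ) y => u (x + t • y)) (F' := fun (t : ℝ) y => fderiv ℝ u (x + t • y) y)
    Filter.univ_mem ?_ ?_ ?_ ?_ (integrable_const C) ?_).2
  · exact Eventually.of_forall fun s =>
      (show Continuous fun y => u (x + s • y) by fun_prop).aestronglyMeasurable
  · exact (show Continuous fun y => u (x + t • y) by
      fun_prop).continuousOn.integrableOn_compact (isCompact_closedBall 0 1)
  · exact (show Continuous fun y => fderiv ℝ u (x + t • y) y from
      (hcd.comp (by fun_prop)).clm_apply continuous_id).aestronglyMeasurable
  · refine ae_restrict_of_forall_mem measurableSet_closedBall fun y hy s _ => ?_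
    rw [mem_closedBall_zero_iff] at hy
    calc ‖fderiv ℝ u (x + s • y) y‖ ≤ ‖fderiv ℝ u (x + s • y)‖ * ‖y‖ :=
          ContinuousLinearMap.le_opNorm _ _
      _ ≤ ‖fderiv ℝ u (x + s • y)‖ * 1 := by gcongr
      _ ≤ C := by simpa using hC (x + s • y)
  · refine ae_of_all _ fun y s _ => ?_
    have h1 : HasDerivAt (fun s : ℝ => x + s • y) y s := by
      simpa using ((hasDerivAt_id s).smul_const y).const_add x
    exact ((hu.1.differentiable (by simp)) _).hasFDerivAt.comp_hasDerivAt s h1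

lemma SmoothCS.neg {d : ℕ} {u : Rd d → ℝ} (hu : SmoothCS d u) : SmoothCS d (-u) :=
  ⟨hu.1.neg, hu.2.neg⟩

/-- Morrey-type estimate at scale `R`. -/
lemma volume_mul_le_morrey {d : ℕ} (hd : 1 ≤ d) {p : ℝ} (hp : (d : ℝ) < p) {u : Rd d → ℝ}
    (hu : SmoothCS d u) (x : Rd d) {R : ℝ} (hR : 0 < R) :
    volume.real (closedBall (0 : Rd d) 1) * u x ≤
      volume.real (closedBall (0 : Rd d) 1) ^ (1 - 1 / p) *
        ((∫ y, |u y| ^ p) ^ (1 / p) * R ^ (-(d / p)) +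
          (∫ y, ‖fderiv ℝ u y‖ ^ p) ^ (1 / p) * (R ^ (1 - d / p) / (1 - d / p))) := by
  have hd1 : (1 : ℝ) ≤ d := by exact_mod_cast hd
  have hp1 : 1 < p := by linarith
  have ha : (d : ℝ) / p < 1 := (div_lt_one (by linarith)).2 hp
  have hcu : Continuous u := hu.1.continuous
  have hcd : Continuous (fderiv ℝ u) := hu.1.continuous_fderiv (by simp)
  have hcpt := isCompact_closedBall (0 : Rd d) 1
  have hincr := sub_le_of_deriv_ge_rpow ha hR.le
    (hasDerivAt_setIntegral_closedBall_comp_smul hu x)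
    (K := volume.real (closedBall (0 : Rd d) 1) ^ (1 - 1 / p) *
      (∫ y, ‖fderiv ℝ u y‖ ^ p) ^ (1 / p)) (fun t ht => by
      refine neg_le_of_abs_le ?_
      calc |∫ y in closedBall (0 : Rd d) 1, fderiv ℝ u (x + t • y) y|
          ≤ ∫ y in closedBall (0 : Rd d) 1, ‖fderiv ℝ u (x + t • y) y‖ := by
            rw [← Real.norm_eq_abs]
            exact norm_integral_le_integral_norm _
        _ ≤ ∫ y in closedBall (0 : Rd d) 1, ‖fderiv ℝ u (x + t • y)‖ := by
            refine setIntegral_mono_on ?_ ?_ measurableSet_closedBall fun y hy => ?_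
            · exact ((hcd.comp (by fun_prop)).clm_apply
                continuous_id).norm.continuousOn.integrableOn_compact hcpt
            · exact (hcd.comp (by fun_prop)).norm.continuousOn.integrableOn_compact hcpt
            · rw [mem_closedBall_zero_iff] at hy
              exact ((fderiv ℝ u (x + t • y)).le_opNorm y).trans
                (mul_le_of_le_one_right (norm_nonneg _) hy)
        _ ≤ _ := setIntegral_closedBall_comp_smul_le hp1 hcd.norm (hu.2.fderiv ℝ).norm
            (fun y => norm_nonneg _) x ht)
  have hzero : ∫ y in closedBall (0 : Rd d) 1, u (x + (0 : ℝ) • y) =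
      volume.real (closedBall (0 : Rd d) 1) * u x := by
    simp
  have hscale : ∫ y in closedBall (0 : Rd d) 1, u (x + R • y) ≤ _ :=
    ((Real.le_norm_self _).trans (norm_integral_le_integral_norm _)).trans
      (setIntegral_closedBall_comp_smul_le hp1 hcu.norm hu.2.norm (fun y => norm_nonneg _) x hR)
  simp only [Real.norm_eq_abs] at hscale
  rw [hzero] at hincr
  linarith

/-- The Gagliardo–Nirenberg–Morrey interpolation inequality with a non-explicit constant. -/
lemma exists_sobolev_constant {d : ℕ} (hd : 1 ≤ d) {p : ℝ} (hp : (d : ℝ) < p) :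
    ∃ S : ℝ, ∀ u : Rd d → ℝ, SmoothCS d u →
      (⨆ x, |u x|) ^ p ≤ S * (∫ x, ‖fderiv ℝ u x‖ ^ p) ^ ((d : ℝ) / p) *
        (∫ x, |u x| ^ p) ^ ((p - d) / p) := by
  have hd1 : (1 : ℝ) ≤ d := by exact_mod_cast hd
  have hp0 : 0 < p := by linarith
  have ha : (d : ℝ) / p < 1 := (div_lt_one hp0).2 hp
  have ha0 : 0 < (d : ℝ) / p := by positivity
  have ha' : 0 < 1 - (d : ℝ) / p := by linarith
  set B := volume.real (closedBall (0 : Rd d) 1)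
  have hB : 0 < B := by
    refine ENNReal.toReal_pos (measure_closedBall_pos volume 0 one_pos).ne'
      (isCompact_closedBall (0 : Rd d) 1).measure_lt_top.ne
  obtain ⟨C, hC⟩ : ∃ C, C = B⁻¹ * (B ^ (1 - 1 / p) * (1 + 1 / (1 - d / p))) := ⟨_, rfl⟩
  have hC0 : 0 ≤ C := by rw [hC]; positivity
  refine ⟨C ^ p, fun u hu => ?_⟩
  set G := ∫ x, ‖fderiv ℝ u x‖ ^ p with hG
  set N := ∫ x, |u x| ^ p with hN
  have hG0 : 0 ≤ G := integral_nonneg fun y => Real.rpow_nonneg (norm_nonneg _) p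
  have hN0 : 0 ≤ N := integral_nonneg fun y => Real.rpow_nonneg (abs_nonneg _) p
  set G' := G ^ (1 / p)
  set N' := N ^ (1 / p)
  have hG'0 : 0 ≤ G' := by positivity
  have hN'0 : 0 ≤ N' := by positivity
  have hone : ∀ v : Rd d → ℝ, SmoothCS d v → ∫ x, ‖fderiv ℝ v x‖ ^ p = G →
      ∫ x, |v x| ^ p = N → ∀ x, v x ≤ C * (G' ^ (d / p) * N' ^ (1 - d / p)) := by
    intro v hv hvG hvN x
    have heps : ∀ ε : ℝ, 0 < ε →
        v x ≤ C * ((G' + ε) ^ (d / p) * (N' + ε) ^ (1 - d / p)) := by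
      intro ε hε
      have hg : 0 < G' + ε := by positivity
      have hn : 0 < N' + ε := by positivity
      have h := volume_mul_le_morrey hd hp hv x (R := (N' + ε) / (G' + ε)) (by positivity)
      rw [hvG, hvN] at h
      set P := (G' + ε) ^ (d / p) * (N' + ε) ^ (1 - d / p) with hP
      have e1 : (N' + ε) * ((N' + ε) / (G' + ε)) ^ (-(d / p)) = P := by
        rw [Real.div_rpow hn.le hg.le, Real.rpow_neg hn.le, Real.rpow_neg hg.le, hP,
          Real.rpow_sub hn, Real.rpow_one]
        field_simp
      have e2 : (G' + ε) * ((N' + ε) / (G' + ε)) ^ (1 - d / p) = P := by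
        rw [Real.div_rpow hn.le hg.le, Real.rpow_sub hg, Real.rpow_one, hP]
        field_simp
      have h2 : N' * ((N' + ε) / (G' + ε)) ^ (-(d / p)) +
          G' * (((N' + ε) / (G' + ε)) ^ (1 - d / p) / (1 - d / p)) ≤
          P + P * (1 / (1 - d / p)) := by
        nth_rw 1 [← e1]
        rw [← e2, mul_assoc, mul_one_div]
        gcongr <;> linarith
      have h3 : B * v x ≤ B * (C * P) := by
        refine h.trans ((mul_le_mul_of_nonneg_left h2 (by positivity)).trans_eq ?_)
        change B ^ (1 - 1 / p) * _ = _
        rw [hC]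
        field_simp
      exact le_of_mul_le_mul_left h3 hB
    have hlim : Tendsto (fun ε : ℝ => C * ((G' + ε) ^ (d / p) * (N' + ε) ^ (1 - d / p)))
        (nhdsWithin 0 (Set.Ioi 0)) (nhds (C * (G' ^ (d / p) * N' ^ (1 - d / p)))) := by
      have hc : Continuous fun ε : ℝ =>
          C * ((G' + ε) ^ (d / p) * (N' + ε) ^ (1 - d / p)) := by
        refine continuous_const.mul (Continuous.mul ?_ ?_)
        · exact (continuous_const.add continuous_id).rpow_const fun _ => Or.inr ha0.le
        · exact (continuous_const.add continuous_id).rpow_const fun _ => Or.inr ha'.le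
      simpa using (hc.tendsto 0).mono_left nhdsWithin_le_nhds
    exact ge_of_tendsto hlim (eventually_mem_nhdsWithin.mono fun ε hε => heps ε hε)
  have hsup : ⨆ x, |u x| ≤ C * (G' ^ (d / p) * N' ^ (1 - d / p)) := by
    refine ciSup_le fun x => abs_le'.2 ⟨hone u hu rfl rfl x, hone (-u) hu.neg ?_ ?_ x⟩
    · simp [hG, fderiv_neg]
    · simp [hN]
  refine (Real.rpow_le_rpow (Real.iSup_nonneg fun x => abs_nonneg _) hsup hp0.le).trans_eq ?_
  rw [Real.mul_rpow hC0 (by positivity), Real.mul_rpow (by positivity) (by positivity),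
    ← Real.rpow_mul hG'0, ← Real.rpow_mul hN'0, ← Real.rpow_mul hG0, ← Real.rpow_mul hN0, mul_assoc]
  congr 3
  · field_simp
  · field_simp

lemma SmoothCS.abs_le_iSup {d : ℕ} {u : Rd d → ℝ} (hu : SmoothCS d u) (x : Rd d) :
    |u x| ≤ ⨆ y, |u y| := by
  obtain ⟨C, hC⟩ := hu.2.exists_bound_of_continuous hu.1.continuous
  exact le_ciSup (f := fun y => |u y|) ⟨C, by rintro _ ⟨y, rfl⟩; exact hC y⟩ x

/-- The sharp constant is nonnegative and admissible. -/
lemma sobolevSharp_spec {d : ℕ} (hd : 1 ≤ d) {p : ℝ} (hp : (d : ℝ) < p) :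
    0 ≤ SobolevSharp d p ∧ ∀ u : Rd d → ℝ, SmoothCS d u →
      (⨆ x, |u x|) ^ p ≤ SobolevSharp d p * (∫ x, ‖fderiv ℝ u x‖ ^ p) ^ ((d : ℝ) / p) *
        (∫ x, |u x| ^ p) ^ ((p - d) / p) := by
  have hnonneg : ∀ u : Rd d → ℝ, 0 ≤ (∫ x, ‖fderiv ℝ u x‖ ^ p) ^ ((d : ℝ) / p) *
      (∫ x, |u x| ^ p) ^ ((p - d) / p) := fun u =>
    mul_nonneg
      (Real.rpow_nonneg (integral_nonneg fun y => Real.rpow_nonneg (norm_nonneg _) p) _)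
      (Real.rpow_nonneg (integral_nonneg fun y => Real.rpow_nonneg (abs_nonneg _) p) _)
  have hne := exists_sobolev_constant hd hp
  have hlow : ∀ S ∈ {S : ℝ | ∀ u : Rd d → ℝ, SmoothCS d u →
      (⨆ x, |u x|) ^ p ≤ S * (∫ x, ‖fderiv ℝ u x‖ ^ p) ^ ((d : ℝ) / p) *
        (∫ x, |u x| ^ p) ^ ((p - d) / p)}, 0 ≤ S := by
    intro S hS
    let φ : ContDiffBump (0 : Rd d) := ⟨1, 2, one_pos, one_lt_two⟩
    have hφ : SmoothCS d φ := ⟨φ.contDiff, φ.hasCompactSupport⟩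
    have h0 : 0 < ⨆ x, |φ x| := by
      refine lt_of_lt_of_le ?_ (hφ.abs_le_iSup 0)
      rw [φ.one_of_mem_closedBall (by simp [φ])]
      norm_num
    have h := (Real.rpow_pos_of_pos h0 p).trans_le (hS φ hφ)
    rw [mul_assoc] at h
    exact (pos_of_mul_pos_left h (hnonneg φ)).le
  refine ⟨le_csInf hne hlow, fun u hu => ?_⟩
  rw [mul_assoc]
  rcases (hnonneg u).eq_or_lt with h | h
  · obtain ⟨S, hS⟩ := hne
    have := hS u hu
    rw [mul_assoc, ← h, mul_zero] at this
    rwa [← h, mul_zero]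
  · rw [← div_le_iff₀ h]
    refine le_csInf hne fun S hS => ?_
    rw [div_le_iff₀ h, ← mul_assoc]
    exact hS u hu

/-- Weighted Young inequality in the form optimised for `G - A G ^ (d / p) N ^ ((p - d) / p)`. -/
lemma mul_rpow_mul_rpow_le {d p A G N : ℝ} (hd : 0 < d) (hp : d < p) (hA : 0 ≤ A) (hG : 0 ≤ G)
    (hN : 0 ≤ N) :
    A * G ^ (d / p) * N ^ ((p - d) / p) ≤
      G + (p - d) / p * (d / p) ^ (d / (p - d)) * A ^ (p / (p - d)) * N := by
  have hp0 : 0 < p := hd.trans hp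
  have hpd : 0 < p - d := sub_pos.2 hp
  have ha : 0 < d / p := by positivity
  have h := Real.geom_mean_le_arith_mean2_weighted (w₁ := d / p) (w₂ := (p - d) / p)
    (p₁ := G / (d / p)) (p₂ := (d / p) ^ (d / (p - d)) * A ^ (p / (p - d)) * N)
    (by positivity) (by positivity) (by positivity) (by positivity) (by field_simp; ring)
  have e1 : (G / (d / p)) ^ (d / p) *
      ((d / p) ^ (d / (p - d)) * A ^ (p / (p - d)) * N) ^ ((p - d) / p) =
      A * G ^ (d / p) * N ^ ((p - d) / p) := by
    rw [Real.mul_rpow (by positivity) hN, Real.mul_rpow (by positivity) (by positivity),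
      ← Real.rpow_mul ha.le, ← Real.rpow_mul hA, Real.div_rpow hG ha.le,
      show d / (p - d) * ((p - d) / p) = d / p by field_simp,
      show p / (p - d) * ((p - d) / p) = 1 by field_simp, Real.rpow_one]
    have := Real.rpow_pos_of_pos ha (d / p)
    generalize (d / p) ^ (d / p) = c at this ⊢
    field_simp
  rw [e1, mul_div_cancel₀ _ ha.ne'] at h
  linarith

/-- Sharp lower bound for Q_V in terms of ∫ V₊ when p > d. -/
theorem stmt5 (d : ℕ) (hd : 1 ≤ d) (p : ℝ) (hp : (d : ℝ) < p)
    (V : Rd d → ℝ) (hV : Integrable V)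
    (u : Rd d → ℝ) (hu : SmoothCS d u) :
    ∫ x, (‖fderiv ℝ u x‖ ^ p - V x * |u x| ^ p) ≥
      -((p - d) / p) * ((d : ℝ) / p) ^ ((d : ℝ) / (p - d)) *
        (SobolevSharp d p * ∫ x, max (V x) 0) ^ (p / (p - d)) * ∫ x, |u x| ^ p := by
  have hd1 : (1 : ℝ) ≤ d := by exact_mod_cast hd
  have hp0 : 0 < p := by linarith
  obtain ⟨hS0, hS⟩ := sobolevSharp_spec hd hp
  have hcu : Continuous u := hu.1.continuous
  have hcd : Continuous (fderiv ℝ u) := hu.1.continuous_fderiv (by simp)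
  have hGi : Integrable fun x => ‖fderiv ℝ u x‖ ^ p :=
    (hcd.norm.rpow_const fun _ => Or.inr hp0.le).integrable_of_hasCompactSupport
      ((hu.2.fderiv ℝ).comp_left (g := fun L => ‖L‖ ^ p) (by simp [hp0.ne']))
  have hbound : ∀ x, |u x| ^ p ≤ (⨆ y, |u y|) ^ p := fun x =>
    Real.rpow_le_rpow (abs_nonneg _) (hu.abs_le_iSup x) hp0.le
  have hpow0 : ∀ x, 0 ≤ |u x| ^ p := fun x => Real.rpow_nonneg (abs_nonneg _) p
  have hVi : Integrable fun x => V x * |u x| ^ p :=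
    hV.mul_bdd (c := (⨆ y, |u y|) ^ p)
      (hcu.abs.rpow_const fun _ => Or.inr hp0.le).aestronglyMeasurable
      (ae_of_all _ fun x => by rw [Real.norm_of_nonneg (hpow0 x)]; exact hbound x)
  have hW0 : 0 ≤ ∫ x, max (V x) 0 := integral_nonneg fun x => le_max_right _ _
  have hVle : ∫ x, V x * |u x| ^ p ≤ (∫ x, max (V x) 0) * (⨆ y, |u y|) ^ p := by
    rw [← integral_mul_const]
    refine integral_mono hVi (hV.pos_part.mul_const _) fun x => ?_
    exact mul_le_mul (le_max_left _ _) (hbound x) (hpow0 x) (le_max_right _ _)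
  have hsob := mul_le_mul_of_nonneg_left (hS u hu) hW0
  have hyoung := mul_rpow_mul_rpow_le (d := d) (p := p) (by linarith) hp (mul_nonneg hS0 hW0)
    (integral_nonneg (μ := volume) fun x => Real.rpow_nonneg (norm_nonneg (fderiv ℝ u x)) p)
    (integral_nonneg (μ := volume) hpow0)
  rw [integral_sub hGi hVi]
  linarith
end
end

section
/- Let d ≥ 2 be an integer, take p = d, and fix σ ∈ (1, d). Define V(x) = |x|^{-d} |log|x||^{-σ} for 0 < |x| ≤ e^{-1} and V(x) = 0 for |x| > e^{-1}. Then V ∈ L^1(ℝ^d), V ≥ 0, and for every α > 0 the set { Q_{αV}[u] / ∫_{ℝ^d}|u|^d dx : u smooth compactly supported, u not identically zero } is not bounded below (i.e. λ_d(αV) = -∞). -/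
open MeasureTheory Filter Metric

noncomputable section

/-- The radial function `|x|^{-d}` restricted to the annulus `a < |x| ≤ b`. -/
def annulusKernel (d : ℕ) (a b : ℝ) (x : Rd d) : ℝ :=
  (Set.Ioc a b).indicator (fun r : ℝ => r ^ (-(d : ℝ))) ‖x‖

lemma pow_pred_mul_rpow_neg {d : ℕ} (hd : 1 ≤ d) {y : ℝ} (hy : 0 < y) :
    y ^ (d - 1) * y ^ (-(d : ℝ)) = y⁻¹ := by
  rw [← Real.rpow_natCast, ← Real.rpow_add hy, ← Real.rpow_neg_one]
  congr 1
  push_cast [hd]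
  ring

lemma pow_mul_indicator_eq {d : ℕ} (hd : 1 ≤ d) {a b y : ℝ} (hy : 0 < y) :
    y ^ (d - 1) • (Set.Ioc a b).indicator (fun r : ℝ => r ^ (-(d : ℝ))) y =
      (Set.Ioc a b).indicator (fun r : ℝ => r⁻¹) y := by
  by_cases h : y ∈ Set.Ioc a b
  · simp only [Set.indicator_of_mem h, smul_eq_mul, pow_pred_mul_rpow_neg hd hy]
  · simp [Set.indicator_of_notMem h]

lemma nontrivial_Rd {d : ℕ} (hd : 1 ≤ d) : Nontrivial (Rd d) := by
  have : Nonempty (Fin d) := ⟨⟨0, hd⟩⟩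
  infer_instance

lemma integrable_annulusKernel {d : ℕ} (hd : 1 ≤ d) {a b : ℝ} (ha : 0 < a) (hab : a ≤ b) :
    Integrable (annulusKernel d a b) := by
  have := nontrivial_Rd hd
  unfold annulusKernel
  rw [integrable_fun_norm_addHaar volume
    (f := (Set.Ioc a b).indicator (fun r : ℝ => r ^ (-(d : ℝ)))), finrank_euclideanSpace_fin,
    integrableOn_congr_fun (fun y (hy : y ∈ Set.Ioi 0) =>
      pow_mul_indicator_eq hd (Set.mem_Ioi.1 hy)) measurableSet_Ioi]
  refine Integrable.integrableOn ?_
  rw [integrable_indicator_iff measurableSet_Ioc,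
    ← intervalIntegrable_iff_integrableOn_Ioc_of_le hab]
  refine intervalIntegral.intervalIntegrable_inv (fun x hx => ?_) continuousOn_id
  rw [Set.uIcc_of_le hab] at hx
  exact (ha.trans_le hx.1).ne'

lemma integral_annulusKernel {d : ℕ} (hd : 1 ≤ d) {a b : ℝ} (ha : 0 < a) (hab : a ≤ b) :
    ∫ x, annulusKernel d a b x =
      d * volume.real (ball (0 : Rd d) 1) * (Real.log b - Real.log a) := by
  have := nontrivial_Rd hd
  unfold annulusKernel
  rw [integral_fun_norm_addHaar volume
    ((Set.Ioc a b).indicator (fun r : ℝ => r ^ (-(d : ℝ)))), finrank_euclideanSpace_fin,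
    setIntegral_congr_fun measurableSet_Ioi (fun y (hy : y ∈ Set.Ioi 0) =>
      pow_mul_indicator_eq hd (Set.mem_Ioi.1 hy)),
    setIntegral_indicator measurableSet_Ioc,
    Set.inter_eq_right.2 (fun y hy => Set.mem_Ioi.2 (ha.trans hy.1)),
    ← intervalIntegral.integral_of_le hab, integral_inv_of_pos ha (ha.trans_le hab),
    Real.log_div (ha.trans_le hab).ne' ha.ne']
  simp [mul_assoc]

lemma continuousOn_neg_log_rpow {σ : ℝ} (hσ : 1 < σ) :
    ContinuousOn (fun y : ℝ => (-Real.log y) ^ (1 - σ)) (Set.Icc 0 (Real.exp (-1))) := by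
  intro y hy
  rcases hy.1.eq_or_lt with rfl | h0
  · have h : Tendsto (fun y : ℝ => (-Real.log y) ^ (1 - σ)) (nhdsWithin 0 (Set.Ioi 0))
        (nhds 0) := by
      have := (tendsto_rpow_neg_atTop (y := σ - 1) (by linarith)).comp
        (tendsto_neg_atBot_atTop.comp Real.tendsto_log_nhdsGT_zero)
      simpa [Function.comp_def] using this
    have h' : ContinuousWithinAt (fun y : ℝ => (-Real.log y) ^ (1 - σ)) (Set.Ioi 0) 0 := by
      have h1 : (1 : ℝ) - σ ≠ 0 := by linarith
      simpa [ContinuousWithinAt, Real.zero_rpow h1] using h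
    exact (continuousWithinAt_Ioi_iff_Ici.1 h').mono fun z hz => hz.1
  · refine ContinuousAt.continuousWithinAt ?_
    have hlog : Real.log y ≤ -1 := by
      rw [← Real.log_exp (-1)]
      exact Real.log_le_log h0 hy.2
    exact ((Real.continuousAt_log h0.ne').neg).rpow_const
      (Or.inl (by simp only [Pi.neg_apply]; linarith))

lemma integrableOn_inv_mul_abs_log_rpow {σ : ℝ} (hσ : 1 < σ) :
    IntegrableOn (fun y : ℝ => y⁻¹ * |Real.log y| ^ (-σ)) (Set.Ioc 0 (Real.exp (-1))) := by
  refine intervalIntegral.integrableOn_deriv_of_nonneg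
    (g := fun y => (σ - 1)⁻¹ * (-Real.log y) ^ (1 - σ))
    (continuousOn_const.mul (continuousOn_neg_log_rpow hσ)) (fun y hy => ?_)
    (fun y hy => mul_nonneg (inv_nonneg.2 hy.1.le) (by positivity))
  have hlog : Real.log y < -1 := by
    rw [← Real.log_exp (-1)]
    exact Real.log_lt_log hy.1 hy.2
  have h := (((Real.hasDerivAt_log hy.1.ne').neg).rpow_const (p := 1 - σ)
    (Or.inl (by simp only [Pi.neg_apply]; linarith))).const_mul (σ - 1)⁻¹
  refine h.congr_deriv ?_
  have h1 : σ - 1 ≠ 0 := by linarith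
  rw [abs_of_neg (by linarith), show 1 - σ - 1 = -σ by ring]
  simp only [Pi.neg_apply]
  field_simp
  ring

lemma integrable_log_potential {d : ℕ} (hd : 1 ≤ d) {σ : ℝ} (hσ : 1 < σ) :
    Integrable (fun x : Rd d => if ‖x‖ ≤ Real.exp (-1) then
      ‖x‖ ^ (-(d : ℝ)) * |Real.log ‖x‖| ^ (-σ) else 0) := by
  have := nontrivial_Rd hd
  rw [integrable_fun_norm_addHaar volume (f := fun r : ℝ => if r ≤ Real.exp (-1) then
      r ^ (-(d : ℝ)) * |Real.log r| ^ (-σ) else 0), finrank_euclideanSpace_fin,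
    integrableOn_congr_fun (g := (Set.Ioc 0 (Real.exp (-1))).indicator
      (fun y : ℝ => y⁻¹ * |Real.log y| ^ (-σ))) _ measurableSet_Ioi]
  · exact ((integrable_indicator_iff measurableSet_Ioc).2
      (integrableOn_inv_mul_abs_log_rpow hσ)).integrableOn
  · intro y hy
    have hy : 0 < y := hy
    by_cases h : y ≤ Real.exp (-1)
    · simp only [h, if_true, smul_eq_mul, Set.indicator_of_mem (Set.mem_Ioc.2 ⟨hy, h⟩)]
      rw [← mul_assoc, pow_pred_mul_rpow_neg hd hy]
    · simp [h]

lemma deriv_smoothTransition_of_nonpos {s : ℝ} (hs : s ≤ 0) :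
    deriv Real.smoothTransition s = 0 := by
  refine IsLocalMin.deriv_eq_zero (Eventually.of_forall fun y => ?_)
  rw [Real.smoothTransition.zero_of_nonpos hs]
  exact Real.smoothTransition.nonneg y

lemma deriv_smoothTransition_of_one_le {s : ℝ} (hs : 1 ≤ s) :
    deriv Real.smoothTransition s = 0 := by
  refine IsLocalMax.deriv_eq_zero (Eventually.of_forall fun y => ?_)
  rw [Real.smoothTransition.one_of_one_le hs]
  exact Real.smoothTransition.le_one y

lemma exists_abs_deriv_smoothTransition_le :
    ∃ C : ℝ, ∀ s, |deriv Real.smoothTransition s| ≤ C := by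
  have hc : Continuous (deriv Real.smoothTransition) :=
    (Real.smoothTransition.contDiff (n := 1)).continuous_deriv le_rfl
  obtain ⟨C, hC⟩ := (isCompact_Icc (a := (0 : ℝ)) (b := 1)).exists_bound_of_continuousOn
    hc.continuousOn
  refine ⟨max C 1, fun s => ?_⟩
  by_cases hs : s ∈ Set.Icc (0 : ℝ) 1
  · exact (hC s hs).trans (le_max_left _ _)
  · rw [Set.mem_Icc, not_and_or, not_le, not_le] at hs
    have h0 : deriv Real.smoothTransition s = 0 := hs.elim
      (fun h => deriv_smoothTransition_of_nonpos h.le)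
      (fun h => deriv_smoothTransition_of_one_le h.le)
    rw [h0, abs_zero]
    positivity

/-- A smooth version of `-log |x| / t - 1`. -/
def logProfile (d : ℕ) (t : ℝ) (x : Rd d) : ℝ :=
  -(2 * t)⁻¹ * Real.log (‖x‖ ^ 2 + Real.exp (-6 * t)) - 1

/-- A smooth logarithmic cutoff, equal to `1` for `|x| ≤ e^{-3t}` and to `0` for
`|x| ≥ e^{-t}`. -/
def logCutoff (d : ℕ) (t : ℝ) (x : Rd d) : ℝ :=
  Real.smoothTransition (logProfile d t x)

section LogCutoff

variable {d : ℕ} {t : ℝ} {x : Rd d}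

lemma logProfile_nonpos (ht : 0 < t) (hx : Real.exp (-t) ≤ ‖x‖) : logProfile d t x ≤ 0 := by
  have h : -2 * t ≤ Real.log (‖x‖ ^ 2 + Real.exp (-6 * t)) := by
    rw [Real.le_log_iff_exp_le (by positivity)]
    have h1 : Real.exp (-2 * t) = Real.exp (-t) ^ 2 := by
      rw [← Real.exp_nat_mul]; congr 1; push_cast; ring
    have h2 : Real.exp (-t) ^ 2 ≤ ‖x‖ ^ 2 := by gcongr
    linarith [Real.exp_pos (-6 * t)]
  have h' := mul_le_mul_of_nonneg_left h (by positivity : 0 ≤ (2 * t)⁻¹)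
  have h'' : (2 * t)⁻¹ * (-2 * t) = -1 := by field_simp
  unfold logProfile
  linarith

lemma one_le_logProfile (ht : 1 ≤ t) (hx : ‖x‖ ≤ Real.exp (-3 * t)) :
    1 ≤ logProfile d t x := by
  have h : Real.log (‖x‖ ^ 2 + Real.exp (-6 * t)) ≤ -4 * t := by
    rw [Real.log_le_iff_le_exp (by positivity)]
    have h1 : Real.exp (-6 * t) = Real.exp (-3 * t) ^ 2 := by
      rw [← Real.exp_nat_mul]; congr 1; push_cast; ring
    have h2 : ‖x‖ ^ 2 ≤ Real.exp (-3 * t) ^ 2 := by gcongr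
    have h3 : Real.exp (-4 * t) = Real.exp (-6 * t) * Real.exp (2 * t) := by
      rw [← Real.exp_add]; congr 1; ring
    have h4 : 2 ≤ Real.exp (2 * t) := by linarith [Real.add_one_le_exp (2 * t)]
    nlinarith [Real.exp_pos (-6 * t)]
  have h' := mul_le_mul_of_nonneg_left h (by positivity : 0 ≤ (2 * t)⁻¹)
  have h'' : (2 * t)⁻¹ * (-4 * t) = -2 := by field_simp; norm_num
  unfold logProfile
  linarith

lemma logCutoff_eq_zero (ht : 0 < t) (hx : Real.exp (-t) ≤ ‖x‖) : logCutoff d t x = 0 :=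
  Real.smoothTransition.zero_of_nonpos (logProfile_nonpos ht hx)

lemma logCutoff_eq_one (ht : 1 ≤ t) (hx : ‖x‖ ≤ Real.exp (-3 * t)) : logCutoff d t x = 1 :=
  Real.smoothTransition.one_of_one_le (one_le_logProfile ht hx)

lemma abs_logCutoff_le_one : |logCutoff d t x| ≤ 1 := by
  rw [logCutoff, abs_of_nonneg (Real.smoothTransition.nonneg _)]
  exact Real.smoothTransition.le_one _

lemma hasCompactSupport_logCutoff (ht : 0 < t) : HasCompactSupport (logCutoff d t) := by
  refine HasCompactSupport.intro (isCompact_closedBall (0 : Rd d) (Real.exp (-t)))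
    fun x hx => logCutoff_eq_zero ht ?_
  simpa using (not_le.1 (by simpa using hx)).le

lemma contDiff_logCutoff : ContDiff ℝ (⊤ : ℕ∞) (logCutoff d t) := by
  refine Real.smoothTransition.contDiff.comp ?_
  refine (contDiff_const.mul (ContDiff.log ?_ fun x => by positivity)).sub contDiff_const
  exact (contDiff_norm_sq ℝ).add contDiff_const

lemma smoothCS_logCutoff (ht : 0 < t) : SmoothCS d (logCutoff d t) :=
  ⟨contDiff_logCutoff, hasCompactSupport_logCutoff ht⟩

lemma fderiv_logCutoff : fderiv ℝ (logCutoff d t) x =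
    deriv Real.smoothTransition (logProfile d t x) •
      (-(2 * t)⁻¹ • ((‖x‖ ^ 2 + Real.exp (-6 * t))⁻¹ • (2 • innerSL ℝ x))) := by
  have h := (((hasStrictFDerivAt_norm_sq x).hasFDerivAt.add_const (Real.exp (-6 * t))).log
    (by positivity)).const_mul (-(2 * t)⁻¹) |>.sub_const 1
  have hψ : HasDerivAt Real.smoothTransition
      (deriv Real.smoothTransition (logProfile d t x)) (logProfile d t x) :=
    ((Real.smoothTransition.contDiff (n := 1)).differentiable one_ne_zero _).hasDerivAt
  exact (hψ.comp_hasFDerivAt x h).fderiv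

lemma norm_fderiv_logCutoff_le (ht : 0 < t) {C : ℝ}
    (hC : ∀ s, |deriv Real.smoothTransition s| ≤ C) (hx : 0 < ‖x‖) :
    ‖fderiv ℝ (logCutoff d t) x‖ ≤ C / t * ‖x‖⁻¹ := by
  have hC0 : 0 ≤ C := (abs_nonneg _).trans (hC 0)
  have hD : (‖x‖ ^ 2 + Real.exp (-6 * t))⁻¹ ≤ (‖x‖ ^ 2)⁻¹ := by
    gcongr
    linarith [Real.exp_pos (-6 * t)]
  rw [fderiv_logCutoff, norm_smul, norm_smul, norm_smul, Real.norm_eq_abs,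
    ← Nat.cast_smul_eq_nsmul ℝ, norm_smul, innerSL_apply_norm, norm_neg, Real.norm_of_nonneg (by positivity),
    Real.norm_of_nonneg (by positivity), Real.norm_of_nonneg (by positivity)]
  calc _ ≤ C * ((2 * t)⁻¹ * ((‖x‖ ^ 2)⁻¹ * (((2 : ℕ) : ℝ) * ‖x‖))) := by
        gcongr
        exact hC _
    _ = _ := by
        push_cast
        field_simp

lemma norm_fderiv_logCutoff_rpow_le (hd : 1 ≤ d) (ht : 1 ≤ t) {C : ℝ}
    (hC : ∀ s, |deriv Real.smoothTransition s| ≤ C) :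
    ‖fderiv ℝ (logCutoff d t) x‖ ^ (d : ℝ) ≤
      (C / t) ^ d * annulusKernel d (Real.exp (-3 * t)) (Real.exp (-t)) x := by
  have hC0 : 0 ≤ C := (abs_nonneg _).trans (hC 0)
  have hd0 : d ≠ 0 := by lia
  by_cases h : ‖x‖ ∈ Set.Ioc (Real.exp (-3 * t)) (Real.exp (-t))
  · have hx : 0 < ‖x‖ := (Real.exp_pos _).trans h.1
    rw [annulusKernel, Set.indicator_of_mem h, Real.rpow_neg hx.le, Real.rpow_natCast,
      Real.rpow_natCast, ← inv_pow, ← mul_pow]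
    exact pow_le_pow_left₀ (norm_nonneg _) (norm_fderiv_logCutoff_le (by linarith) hC hx) d
  · have h0 : deriv Real.smoothTransition (logProfile d t x) = 0 := by
      rw [Set.mem_Ioc, not_and_or, not_lt, not_le] at h
      exact h.elim (fun h => deriv_smoothTransition_of_one_le (one_le_logProfile ht h))
        (fun h => deriv_smoothTransition_of_nonpos (logProfile_nonpos (by linarith) h.le))
    rw [annulusKernel, Set.indicator_of_notMem h, fderiv_logCutoff, h0]
    simp [hd0]

lemma integral_abs_logCutoff_pos (ht : 1 ≤ t) :
    0 < ∫ x, |logCutoff d t x| ^ (d : ℝ) := by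
  rcases Nat.eq_zero_or_pos d with rfl | hd
  · simp [measureReal_def, volume_euclideanSpace_eq_dirac]
  refine Continuous.integral_pos_of_hasCompactSupport_nonneg_nonzero (x := 0)
    (contDiff_logCutoff.continuous.abs.rpow_const fun _ => Or.inr (by positivity))
    ((hasCompactSupport_logCutoff (by linarith)).comp_left
      (g := fun s : ℝ => |s| ^ (d : ℝ)) (by simp [hd.ne']))
    (fun x => by positivity) ?_
  rw [logCutoff_eq_one ht (by simp [Real.exp_nonneg])]
  simp

lemma integral_abs_logCutoff_le (hd : 1 ≤ d) (ht : 0 < t) :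
    ∫ x, |logCutoff d t x| ^ (d : ℝ) ≤
      Real.exp (-t) ^ d * volume.real (ball (0 : Rd d) 1) := by
  have := nontrivial_Rd hd
  have hd0 : d ≠ 0 := by lia
  have hfin : volume (closedBall (0 : Rd d) (Real.exp (-t))) ≠ ⊤ := measure_closedBall_lt_top.ne
  calc ∫ x, |logCutoff d t x| ^ (d : ℝ)
      ≤ ∫ x, (closedBall (0 : Rd d) (Real.exp (-t))).indicator (fun _ => (1 : ℝ)) x := by
        refine integral_mono_of_nonneg (Eventually.of_forall fun x => by positivity) ?_
          (Eventually.of_forall fun x => ?_)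
        · exact (integrable_indicator_iff measurableSet_closedBall).2
            (integrableOn_const hfin)
        · by_cases h : x ∈ closedBall (0 : Rd d) (Real.exp (-t))
          · simp only [Set.indicator_of_mem h]
            exact Real.rpow_le_one (abs_nonneg _) abs_logCutoff_le_one (by positivity)
          · have h' : Real.exp (-t) ≤ ‖x‖ := (not_le.1 (by simpa using h)).le
            simp [Set.indicator_of_notMem h, logCutoff_eq_zero ht h', hd0]
    _ = _ := by
        rw [integral_indicator measurableSet_closedBall, setIntegral_const, smul_eq_mul, mul_one,
          Measure.addHaar_real_closedBall _ _ (Real.exp_nonneg _), finrank_euclideanSpace_fin]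

end LogCutoff

/-- The potential dominates a multiple of `|x|^{-d}` on the annulus `e^{-4t} < |x| ≤ e^{-3t}`,
where the cutoff equals `1`. -/
lemma annulusKernel_le_potential_mul {d : ℕ} {t σ : ℝ} (ht : 1 ≤ t) (hσ : 0 ≤ σ) (x : Rd d) :
    (4 * t) ^ (-σ) * annulusKernel d (Real.exp (-4 * t)) (Real.exp (-3 * t)) x ≤
      (if ‖x‖ ≤ Real.exp (-1) then ‖x‖ ^ (-(d : ℝ)) * |Real.log ‖x‖| ^ (-σ) else 0) *
        |logCutoff d t x| ^ (d : ℝ) := by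
  by_cases h : ‖x‖ ∈ Set.Ioc (Real.exp (-4 * t)) (Real.exp (-3 * t))
  · have hx : 0 < ‖x‖ := (Real.exp_pos _).trans h.1
    have h1 : ‖x‖ ≤ Real.exp (-1) := h.2.trans (Real.exp_le_exp.2 (by linarith))
    have hlo : -4 * t < Real.log ‖x‖ := (Real.lt_log_iff_exp_lt hx).2 h.1
    have hhi : Real.log ‖x‖ ≤ -3 * t := (Real.log_le_iff_le_exp hx).2 h.2
    rw [annulusKernel, Set.indicator_of_mem h, if_pos h1, logCutoff_eq_one ht h.2, abs_one,
      Real.one_rpow, mul_one, mul_comm, abs_of_neg (by linarith)]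
    gcongr ?_ * ?_
    exact Real.rpow_le_rpow_of_nonpos (by linarith) (by linarith) (by linarith)
  · rw [annulusKernel, Set.indicator_of_notMem h, mul_zero]
    refine mul_nonneg ?_ (by positivity)
    split_ifs <;> positivity

/-- The energy of the logarithmic cutoffs. -/
lemma Qf_logCutoff_le {d : ℕ} (hd : 1 ≤ d) {t σ α C : ℝ} (ht : 1 ≤ t) (hσ : 1 < σ)
    (hα : 0 < α) (hC : ∀ s, |deriv Real.smoothTransition s| ≤ C) :
    Qf d d (fun x => α * (if ‖x‖ ≤ Real.exp (-1) then
        ‖x‖ ^ (-(d : ℝ)) * |Real.log ‖x‖| ^ (-σ) else 0)) (logCutoff d t) ≤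
      d * volume.real (ball (0 : Rd d) 1) * t *
        (2 * (C / t) ^ d - α * (4 * t) ^ (-σ)) := by
  have hd0 : d ≠ 0 := by lia
  have hint₁ := integrable_annulusKernel hd (Real.exp_pos (-3 * t))
    (Real.exp_le_exp.2 (by linarith : -3 * t ≤ -t))
  have hint₂ := integrable_annulusKernel hd (Real.exp_pos (-4 * t))
    (Real.exp_le_exp.2 (by linarith : -4 * t ≤ -3 * t))
  have hu : Continuous (logCutoff d t) := contDiff_logCutoff.continuous
  have hgrad : Integrable fun x => ‖fderiv ℝ (logCutoff d t) x‖ ^ (d : ℝ) := by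
    refine Continuous.integrable_of_hasCompactSupport ?_ ?_
    · exact (contDiff_logCutoff.continuous_fderiv (by simp)).norm.rpow_const
        fun _ => Or.inr (by positivity)
    · exact ((hasCompactSupport_logCutoff (by linarith)).fderiv ℝ).comp_left
        (g := fun L : Rd d →L[ℝ] ℝ => ‖L‖ ^ (d : ℝ)) (by simp [hd0])
  have hpot := ((integrable_log_potential hd hσ).const_mul α).mul_bdd (c := 1)
    (g := fun x => |logCutoff d t x| ^ (d : ℝ))
    (hu.abs.rpow_const fun _ => Or.inr (by positivity)).aestronglyMeasurable
    (Eventually.of_forall fun x => by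
      rw [Real.norm_of_nonneg (by positivity)]
      exact Real.rpow_le_one (abs_nonneg _) abs_logCutoff_le_one (by positivity))
  refine (integral_mono (hgrad.sub hpot) ((hint₁.const_mul ((C / t) ^ d)).sub
    (hint₂.const_mul (α * (4 * t) ^ (-σ)))) fun x => ?_).trans_eq ?_
  · have h := mul_le_mul_of_nonneg_left
      (annulusKernel_le_potential_mul (d := d) ht (by linarith : 0 ≤ σ) x) hα.le
    have h' := norm_fderiv_logCutoff_rpow_le (x := x) hd ht hC
    simp only [Pi.sub_apply]
    linarith
  · rw [integral_sub' (hint₁.const_mul _) (hint₂.const_mul _), integral_const_mul,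
      integral_const_mul,
      integral_annulusKernel hd (Real.exp_pos _) (Real.exp_le_exp.2 (by linarith)),
      integral_annulusKernel hd (Real.exp_pos _) (Real.exp_le_exp.2 (by linarith))]
    simp only [Real.log_exp]
    ring

/-- The Rayleigh quotient of `logCutoff d t` is at most `-t` for large `t`. -/
lemma eventually_rayleigh_logCutoff_le {d : ℕ} (hd : 1 ≤ d) {σ α : ℝ} (hσ : 1 < σ)
    (hσd : σ < (d : ℝ)) (hα : 0 < α) :
    ∀ᶠ t : ℝ in atTop, Qf d d (fun x => α * (if ‖x‖ ≤ Real.exp (-1) then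
        ‖x‖ ^ (-(d : ℝ)) * |Real.log ‖x‖| ^ (-σ) else 0)) (logCutoff d t) /
      ∫ x, |logCutoff d t x| ^ (d : ℝ) ≤ -t := by
  obtain ⟨C, hC⟩ := exists_abs_deriv_smoothTransition_le
  have hlim : Tendsto (fun t : ℝ => α * (4 : ℝ) ^ (-σ) * t ^ ((d : ℝ) - σ)) atTop atTop :=
    (tendsto_rpow_atTop (by linarith)).const_mul_atTop (by positivity)
  filter_upwards [eventually_ge_atTop 1, hlim.eventually_ge_atTop (2 * C ^ d + 1)] with t ht hbig
  have ht0 : 0 < t := by linarith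
  have hω : 0 < volume.real (ball (0 : Rd d) 1) :=
    ENNReal.toReal_pos (measure_ball_pos _ _ one_pos).ne' measure_ball_lt_top.ne
  set ω := volume.real (ball (0 : Rd d) 1)
  have hbr : 2 * (C / t) ^ d - α * (4 * t) ^ (-σ) ≤ -(t ^ d)⁻¹ := by
    have h1 : (4 * t) ^ (-σ) = (4 : ℝ) ^ (-σ) * t ^ ((d : ℝ) - σ) * (t ^ d)⁻¹ := by
      rw [Real.mul_rpow (by norm_num) ht0.le, sub_eq_add_neg, Real.rpow_add ht0,
        Real.rpow_natCast]
      field_simp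
    have h2 := mul_le_mul_of_nonneg_right hbig (by positivity : 0 ≤ (t ^ d)⁻¹)
    rw [h1, div_pow, div_eq_mul_inv]
    linarith
  have hQ := (Qf_logCutoff_le hd ht hσ hα hC).trans
    (mul_le_mul_of_nonneg_left hbr (by positivity : 0 ≤ d * ω * t))
  have hDle := integral_abs_logCutoff_le hd ht0
  rw [div_le_iff₀ (integral_abs_logCutoff_pos ht)]
  refine hQ.trans ?_
  have hexp : Real.exp (-t) ^ d ≤ (t ^ d)⁻¹ := by
    rw [Real.exp_neg, inv_pow]
    gcongr
    linarith [Real.add_one_le_exp t]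
  have hd1 : (1 : ℝ) ≤ d := by exact_mod_cast hd
  have h3 : ∫ x, |logCutoff d t x| ^ (d : ℝ) ≤ d * ((t ^ d)⁻¹ * ω) :=
    calc _ ≤ Real.exp (-t) ^ d * ω := hDle
      _ ≤ (t ^ d)⁻¹ * ω := by gcongr
      _ ≤ _ := le_mul_of_one_le_left (by positivity) hd1
  have h4 := mul_le_mul_of_nonneg_left h3 ht0.le
  linarith

/-- For p = d there exist nonnegative integrable potentials for which
λ_d(αV) = -∞ for every α > 0. -/
theorem stmt8 (d : ℕ) (hd : 2 ≤ d) (σ : ℝ) (hσ1 : 1 < σ) (hσd : σ < (d : ℝ))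
    (V : Rd d → ℝ)
    (hVdef : ∀ x : Rd d, V x =
      if ‖x‖ ≤ Real.exp (-1) then ‖x‖ ^ (-(d : ℝ)) * |Real.log ‖x‖| ^ (-σ) else 0) :
    Integrable V ∧ (∀ x, 0 ≤ V x) ∧
    ∀ α : ℝ, 0 < α →
      ¬ BddBelow {r : ℝ | ∃ u : Rd d → ℝ, SmoothCS d u ∧ u ≠ 0 ∧
        r = Qf d d (fun x => α * V x) u / ∫ x, |u x| ^ (d : ℝ)} := by
  have hd1 : 1 ≤ d := by lia
  obtain rfl : V = fun x => if ‖x‖ ≤ Real.exp (-1) then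
      ‖x‖ ^ (-(d : ℝ)) * |Real.log ‖x‖| ^ (-σ) else 0 := funext hVdef
  refine ⟨integrable_log_potential hd1 hσ1, fun x => ?_, ?_⟩
  · dsimp only
    split_ifs <;> positivity
  · rintro α hα ⟨m, hm⟩
    obtain ⟨t, ht, ht1, htm⟩ := ((eventually_rayleigh_logCutoff_le hd1 hσ1 hσd hα).and
      ((eventually_ge_atTop 1).and (eventually_gt_atTop (-m)))).exists
    have hne : logCutoff d t ≠ 0 := fun h => by
      have h1 := logCutoff_eq_one (x := (0 : Rd d)) ht1 (by simp [Real.exp_nonneg])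
      simp [h] at h1
    have := hm ⟨logCutoff d t, smoothCS_logCutoff (by linarith), hne, rfl⟩
    linarith
end
end
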